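/- arXiv:1203.2723 — 2 statements merged into one kernel-verified Lean document; each statement's English description precedes it below -/
import Mathlib

section
/- There exists n₀ such that for all n ≥ n₀: if G is a simple graph on n vertices with independence number at most 2 and t₄(G) = f(n,4,3), then the vertex set of G admits a partition V₁,...,V₅ such that |V_i| = b_i for each i, where (b₁,...,b₅) is defined by: if n = 5k then (k,k,k,k,k); if n = 5k+1 then (k,k,k+1,k−1,k+1); if n = 5k+2 then (k,k,k+1,k,k+1); if n = 5k+3 then (k+1,k+1,k,k+1,k); if n = 5k+4 then (k+1,k+1,k,k+2,k); and two distinct vertices are adjacent in G if and only if they lie in the same part V_i or in cyclically consecutive parts V_i and V_{i+1} (indices modulo 5). In other words, the extremal graph for the (4,3)-problem is the unique blow-up of the 5-cycle C₅ with these part sizes. -/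
/-- `G` has no independent set with more than `m` vertices, i.e. α(G) ≤ m. -/
def IndepBound {V : Type*} (G : SimpleGraph V) (m : ℕ) : Prop :=
  ∀ s : Finset V, (∀ u ∈ s, ∀ v ∈ s, u ≠ v → ¬ G.Adj u v) → s.card ≤ m

/-- the number of `k`-cliques of `G`. -/
noncomputable def cliqueCount {V : Type*} [Fintype V] (G : SimpleGraph V) (k : ℕ) : ℕ :=
  Nat.card {s : Finset V // s.card = k ∧ G.IsClique (s : Set V)}

/-- `f(n,k,l)`: the minimum number of `k`-cliques over graphs on `n` vertices with
independence number at most `l − 1`. -/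
noncomputable def minCliques (n k l : ℕ) : ℕ :=
  sInf {m | ∃ G : SimpleGraph (Fin n), IndepBound G (l - 1) ∧ cliqueCount G k = m}

/-- The part sizes (b₁,…,b₅) of the extremal blow-up of C₅ on n vertices. -/
def bPart (n : ℕ) : Fin 5 → ℕ :=
  let k := n / 5
  if n % 5 = 0 then ![k, k, k, k, k]
  else if n % 5 = 1 then ![k, k, k + 1, k - 1, k + 1]
  else if n % 5 = 2 then ![k, k, k + 1, k, k + 1]
  else if n % 5 = 3 then ![k + 1, k + 1, k, k + 1, k]
  else ![k + 1, k + 1, k, k + 2, k]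

namespace PentagonBlowUp

/-- Integer-valued functions of the adjacency pattern of five points, the arguments being the
pairs `01, 02, 03, 04, 12, 13, 14, 23, 24, 34`. -/
abbrev PatternFun := Bool → Bool → Bool → Bool → Bool → Bool → Bool → Bool → Bool → Bool → ℤ

/-- The transposition of the points 0 and 1. -/
def swap01 (F : PatternFun) : PatternFun := fun a b c d e f g h i j => F a e f g b c d h i j
/-- The transposition of the points 1 and 2. -/
def swap12 (F : PatternFun) : PatternFun := fun a b c d e f g h i j => F b a c d e h i f g j
/-- The transposition of the points 2 and 3. -/
def swap23 (F : PatternFun) : PatternFun := fun a b c d e f g h i j => F a c b d f e g h j i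
/-- The transposition of the points 3 and 4. -/
def swap34 (F : PatternFun) : PatternFun := fun a b c d e f g h i j => F a b d c e g f i h j

/-- A pattern function plus the relabelling `s G` of another one. -/
def addSwap (s : PatternFun → PatternFun) (F G : PatternFun) : PatternFun :=
  fun a b c d e f g h i j => F a b c d e f g h i j + s G a b c d e f g h i j

/-- The sum over coset representatives of the permutations of the points 0 and 1. -/
def sym2 (F : PatternFun) : PatternFun := addSwap swap01 F F
/-- The sum over coset representatives extending the symmetrisation to 3 points. -/
def sym3 (F : PatternFun) : PatternFun := addSwap swap12 F (addSwap swap01 F F)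
/-- The sum over coset representatives extending the symmetrisation to 4 points. -/
def sym4 (F : PatternFun) : PatternFun :=
  addSwap swap23 F (addSwap swap12 F (addSwap swap01 F F))
/-- The sum over coset representatives extending the symmetrisation to 5 points. -/
def sym5 (F : PatternFun) : PatternFun :=
  addSwap swap34 F (addSwap swap23 F (addSwap swap12 F (addSwap swap01 F F)))

/-- The indicator of a Boolean, as an integer. -/
def bi (b : Bool) : ℤ := bif b then 1 else 0

/-- The symmetric bilinear form with upper triangular coefficients `m`. -/
def form4 (m : Fin 10 → ℤ) (x₀ x₁ x₂ x₃ y₀ y₁ y₂ y₃ : ℤ) : ℤ :=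
  m 0 * x₀ * y₀ + m 1 * (x₀ * y₁ + x₁ * y₀) + m 2 * (x₀ * y₂ + x₂ * y₀)
    + m 3 * (x₀ * y₃ + x₃ * y₀) + m 4 * x₁ * y₁ + m 5 * (x₁ * y₂ + x₂ * y₁)
    + m 6 * (x₁ * y₃ + x₃ * y₁) + m 7 * x₂ * y₂ + m 8 * (x₂ * y₃ + x₃ * y₂) + m 9 * x₃ * y₃

/-- The coefficients of a flag algebra certificate on five points. -/
structure Cert where
  ind : ℤ
  cyc : ℤ
  cst : ℤ
  dot : Fin 10 → ℤ
  e11 : ℤ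
  e12 : ℤ
  e22 : ℤ
  e33 : ℤ

/-- First vector of attachments of a point to an edge together with a non-neighbour of it. -/
def att1 (x y z : Bool) : ℤ := (bi x + bi y) * (2 * bi z - 1)
/-- Second vector of attachments. -/
def att2 (x y z : Bool) : ℤ := 2 * bi (!x && !y && !z) - (bi x + bi y) * bi z
/-- Antisymmetric vector of attachments. -/
def att3 (x y : Bool) : ℤ := bi x - bi y

/-- The pattern function of a certificate: the slack of the inequality to be certified. -/
def Cert.fn (C : Cert) : PatternFun := fun a b c d e f g h i j =>
  C.ind * bi (!a && !b && !c && !e && !f && !h) + C.cyc * bi (a && e && h && j && d) - C.cst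
  - form4 C.dot (25 * bi a - 10) (25 * bi e - 10) (25 * bi (a && b) - 4) (25 * bi (a && e) - 4)
      (25 * bi c - 10) (25 * bi j - 10) (25 * bi (c && d) - 4) (25 * bi (c && j) - 4)
  - 625 * (bi (a && !b && !e) *
    (C.e11 * (att1 c f h * att1 d g i) + C.e12 * (att1 c f h * att2 d g i + att2 c f h * att1 d g i)
      + C.e22 * (att2 c f h * att2 d g i) + C.e33 * (att3 c f * att3 d g)))

/-- The pattern is triangle-free. -/
def triFree (a b c d e f g h i j : Bool) : Bool :=
  !(a && b && e) && !(a && c && f) && !(a && d && g) && !(b && c && h) && !(b && d && i) &&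
  !(c && d && j) && !(e && f && h) && !(e && g && i) && !(f && g && j) && !(h && i && j)

/-- Certificate bounding independent quadruples below, with a term in the degrees. -/
def certA : Cert := ⟨5000, 0, 600, ![104, 16, -122, -20, 12, -18, -10, 164, 2, 32], 3, -2, 4, 71⟩
/-- Certificate bounding pentagons below. -/
def certB : Cert := ⟨12500, 30000, 1510, ![284, 52, -232, -174, 14, -41, -35, 236, 95, 158],
  3, -5, 9, 88⟩

/-- The symmetrised slack is nonnegative on triangle-free patterns. -/
def Cert.Valid (C : Cert) : Prop := ∀ a b c d e f g h i j : Bool,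
  triFree a b c d e f g h i j = true →
    0 ≤ sym2 (sym3 (sym4 (sym5 C.fn))) a b c d e f g h i j

section Certificates

variable {V : Type*} [Fintype V]

/-- The sum of a pattern function over all 5-tuples of points. -/
def patternSum (A : V → V → Bool) (F : PatternFun) : ℤ :=
  ∑ x, ∑ y, ∑ z, ∑ u, ∑ w,
    F (A x y) (A x z) (A x u) (A x w) (A y z) (A y u) (A y w) (A z u) (A z w) (A u w)

theorem patternSum_swap01 {A : V → V → Bool} (hA : ∀ x y, A x y = A y x) (F : PatternFun) :
    patternSum A (swap01 F) = patternSum A F := by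
  unfold patternSum swap01
  rw [Finset.sum_comm]
  refine Finset.sum_congr rfl fun x _ => Finset.sum_congr rfl fun y _ => ?_
  rw [hA x y]

theorem patternSum_swap12 {A : V → V → Bool} (hA : ∀ x y, A x y = A y x) (F : PatternFun) :
    patternSum A (swap12 F) = patternSum A F := by
  unfold patternSum swap12
  refine Finset.sum_congr rfl fun x _ => ?_
  rw [Finset.sum_comm]
  refine Finset.sum_congr rfl fun y _ => Finset.sum_congr rfl fun z _ => ?_
  rw [hA y z]

theorem patternSum_swap23 {A : V → V → Bool} (hA : ∀ x y, A x y = A y x) (F : PatternFun) :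
    patternSum A (swap23 F) = patternSum A F := by
  unfold patternSum swap23
  refine Finset.sum_congr rfl fun x _ => Finset.sum_congr rfl fun y _ => ?_
  rw [Finset.sum_comm]
  refine Finset.sum_congr rfl fun z _ => Finset.sum_congr rfl fun u _ => ?_
  rw [hA z u]

theorem patternSum_swap34 {A : V → V → Bool} (hA : ∀ x y, A x y = A y x) (F : PatternFun) :
    patternSum A (swap34 F) = patternSum A F := by
  unfold patternSum swap34
  refine Finset.sum_congr rfl fun x _ => Finset.sum_congr rfl fun y _ =>
    Finset.sum_congr rfl fun z _ => ?_
  rw [Finset.sum_comm]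
  refine Finset.sum_congr rfl fun u _ => Finset.sum_congr rfl fun w _ => ?_
  rw [hA u w]

theorem patternSum_addSwap (A : V → V → Bool) (s : PatternFun → PatternFun) (F G : PatternFun) :
    patternSum A (addSwap s F G) = patternSum A F + patternSum A (s G) := by
  simp only [patternSum, addSwap, Finset.sum_add_distrib]

theorem patternSum_sym {A : V → V → Bool} (hA : ∀ x y, A x y = A y x) (F : PatternFun) :
    patternSum A (sym2 (sym3 (sym4 (sym5 F)))) = 120 * patternSum A F := by
  simp only [sym2, sym3, sym4, sym5, patternSum_addSwap, patternSum_swap01 hA,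
    patternSum_swap12 hA, patternSum_swap23 hA, patternSum_swap34 hA]
  ring

theorem Cert.Valid.patternSum_nonneg {C : Cert} (hC : C.Valid) {A : V → V → Bool}
    (hA : ∀ x y, A x y = A y x) (hT : ∀ x y z, (A x y && A x z && A y z) = false) :
    0 ≤ patternSum A C.fn := by
  have h : 0 ≤ patternSum A (sym2 (sym3 (sym4 (sym5 C.fn)))) := by
    refine Finset.sum_nonneg fun x _ => Finset.sum_nonneg fun y _ => Finset.sum_nonneg fun z _ =>
      Finset.sum_nonneg fun u _ => Finset.sum_nonneg fun w _ => hC _ _ _ _ _ _ _ _ _ _ ?_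
    simp only [triFree, hT, Bool.not_false, Bool.and_self]
  rw [patternSum_sym hA] at h
  omega

/-- The number of ordered independent quadruples, repetitions allowed. -/
def indepTuples (A : V → V → Bool) : ℤ :=
  ∑ x, ∑ y, ∑ z, ∑ u, bi (!A x y && !A x z && !A x u && !A y z && !A y u && !A z u)

/-- The number of ordered pentagons. -/
def pentagons (A : V → V → Bool) : ℤ :=
  ∑ x, ∑ y, ∑ z, ∑ u, ∑ w, bi (A x y && A y z && A z u && A u w && A x w)

theorem sum_form4 (m : Fin 10 → ℤ) (f₀ f₁ f₂ f₃ : V → V → ℤ) :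
    ∑ y, ∑ z, ∑ u, ∑ w, form4 m (f₀ y z) (f₁ y z) (f₂ y z) (f₃ y z)
      (f₀ u w) (f₁ u w) (f₂ u w) (f₃ u w) =
    form4 m (∑ y, ∑ z, f₀ y z) (∑ y, ∑ z, f₁ y z) (∑ y, ∑ z, f₂ y z) (∑ y, ∑ z, f₃ y z)
      (∑ y, ∑ z, f₀ y z) (∑ y, ∑ z, f₁ y z) (∑ y, ∑ z, f₂ y z) (∑ y, ∑ z, f₃ y z) := by
  simp only [form4, mul_assoc, Finset.sum_add_distrib, ← Finset.mul_sum,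
    ← Finset.sum_mul]

theorem sum_edgeForm (a b c d : ℤ) (f₁ f₂ f₃ : V → ℤ) :
    ∑ u, ∑ w, (a * (f₁ u * f₁ w) + b * (f₁ u * f₂ w + f₂ u * f₁ w) + c * (f₂ u * f₂ w)
      + d * (f₃ u * f₃ w)) =
    a * (∑ u, f₁ u) ^ 2 + 2 * b * ((∑ u, f₁ u) * ∑ u, f₂ u) + c * (∑ u, f₂ u) ^ 2
      + d * (∑ u, f₃ u) ^ 2 := by
  simp only [Finset.sum_add_distrib, ← Finset.mul_sum, ← Finset.sum_mul]
  ring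

/-- The quadratic form attached to a point. -/
def Cert.dotTerm (C : Cert) (A : V → V → Bool) (x : V) : ℤ :=
  form4 C.dot (∑ y, ∑ _z : V, (25 * bi (A x y) - 10)) (∑ y, ∑ z, (25 * bi (A y z) - 10))
    (∑ y, ∑ z, (25 * bi (A x y && A x z) - 4)) (∑ y, ∑ z, (25 * bi (A x y && A y z) - 4))
    (∑ y, ∑ _z : V, (25 * bi (A x y) - 10)) (∑ y, ∑ z, (25 * bi (A y z) - 10))
    (∑ y, ∑ z, (25 * bi (A x y && A x z) - 4)) (∑ y, ∑ z, (25 * bi (A x y && A y z) - 4))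

theorem bi_nonneg (b : Bool) : 0 ≤ bi b := by cases b <;> decide

/-- A valid certificate whose edge form is positive semidefinite yields an inequality. -/
theorem Cert.Valid.sum_dotTerm_le {C : Cert} (hC : C.Valid)
    (hE : ∀ a b c : ℤ, 0 ≤ C.e11 * a ^ 2 + 2 * C.e12 * (a * b) + C.e22 * b ^ 2 + C.e33 * c ^ 2)
    {A : V → V → Bool}
    (hA : ∀ x y, A x y = A y x) (hT : ∀ x y z, (A x y && A x z && A y z) = false) :
    C.cst * (Fintype.card V : ℤ) ^ 5 + ∑ x, C.dotTerm A x ≤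
      C.ind * (Fintype.card V * indepTuples A) + C.cyc * pentagons A := by
  have h := hC.patternSum_nonneg hA hT
  have key : patternSum A C.fn = C.ind * (Fintype.card V * indepTuples A) + C.cyc * pentagons A
      - C.cst * (Fintype.card V : ℤ) ^ 5 - ∑ x, C.dotTerm A x
      - 625 * ∑ x, ∑ y, ∑ z, bi (A x y && !A x z && !A y z) *
        (C.e11 * (∑ u, att1 (A x u) (A y u) (A z u)) ^ 2
        + 2 * C.e12 * ((∑ u, att1 (A x u) (A y u) (A z u)) * ∑ u, att2 (A x u) (A y u) (A z u))
        + C.e22 * (∑ u, att2 (A x u) (A y u) (A z u)) ^ 2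
        + C.e33 * (∑ u, att3 (A x u) (A y u)) ^ 2) := by
    simp only [patternSum, Cert.fn, Finset.sum_sub_distrib, Finset.sum_add_distrib]
    congr 1
    · congr 1
      · congr 1
        · congr 1
          · simp only [indepTuples, ← Finset.mul_sum, Finset.sum_const, Finset.card_univ,
              nsmul_eq_mul]
          · simp only [pentagons, ← Finset.mul_sum]
        · simp only [Finset.sum_const, Finset.card_univ, nsmul_eq_mul]
          ring
      · refine Finset.sum_congr rfl fun x _ => ?_
        exact sum_form4 C.dot (fun y _ => 25 * bi (A x y) - 10) (fun y z => 25 * bi (A y z) - 10)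
          (fun y z => 25 * bi (A x y && A x z) - 4) (fun y z => 25 * bi (A x y && A y z) - 4)
    · simp only [← Finset.mul_sum]
      congr 1
      refine Finset.sum_congr rfl fun x _ => Finset.sum_congr rfl fun y _ =>
        Finset.sum_congr rfl fun z _ => ?_
      congr 1
      exact sum_edgeForm C.e11 C.e12 C.e22 C.e33 (fun u => att1 (A x u) (A y u) (A z u))
        (fun u => att2 (A x u) (A y u) (A z u)) (fun u => att3 (A x u) (A y u))
  have h2 : 0 ≤ ∑ x, ∑ y, ∑ z, bi (A x y && !A x z && !A y z) *
        (C.e11 * (∑ u, att1 (A x u) (A y u) (A z u)) ^ 2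
        + 2 * C.e12 * ((∑ u, att1 (A x u) (A y u) (A z u)) * ∑ u, att2 (A x u) (A y u) (A z u))
        + C.e22 * (∑ u, att2 (A x u) (A y u) (A z u)) ^ 2
        + C.e33 * (∑ u, att3 (A x u) (A y u)) ^ 2) :=
    Finset.sum_nonneg fun x _ => Finset.sum_nonneg fun y _ => Finset.sum_nonneg fun z _ =>
      mul_nonneg (bi_nonneg _) (hE _ _ _)
  linarith

theorem sq_le_dotTerm_certA (A : V → V → Bool) (x : V) :
    (Fintype.card V * (25 * ∑ y, bi (A x y) - 10 * Fintype.card V)) ^ 2 ≤ certA.dotTerm A x := by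
  have h : ∑ y, ∑ _z : V, (25 * bi (A x y) - 10) =
      Fintype.card V * (25 * ∑ y, bi (A x y) - 10 * Fintype.card V) := by
    simp only [Finset.sum_const, Finset.card_univ, nsmul_eq_mul, ← Finset.mul_sum,
      Finset.sum_sub_distrib]
    ring
  unfold Cert.dotTerm
  rw [h]
  generalize (Fintype.card V * (25 * ∑ y, bi (A x y) - 10 * Fintype.card V) : ℤ) = p
  generalize (∑ y, ∑ z, (25 * bi (A y z) - 10) : ℤ) = q
  generalize (∑ y, ∑ z, (25 * bi (A x y && A x z) - 4) : ℤ) = r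
  generalize (∑ y, ∑ z, (25 * bi (A x y && A y z) - 4) : ℤ) = s
  simp only [form4, certA, Matrix.cons_val]
  nlinarith [sq_nonneg (-10 * p - 5 * q + r + 16 * s), sq_nonneg (-966 * p - 139 * q + 1311 * r),
    sq_nonneg (-2001 * p + 4610 * q), sq_nonneg p]

theorem dotTerm_certB_nonneg (A : V → V → Bool) (x : V) : 0 ≤ certB.dotTerm A x := by
  unfold Cert.dotTerm
  generalize (∑ y, ∑ _z : V, (25 * bi (A x y) - 10) : ℤ) = p
  generalize (∑ y, ∑ z, (25 * bi (A y z) - 10) : ℤ) = q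
  generalize (∑ y, ∑ z, (25 * bi (A x y && A x z) - 4) : ℤ) = r
  generalize (∑ y, ∑ z, (25 * bi (A x y && A y z) - 4) : ℤ) = s
  simp only [form4, certB, Matrix.cons_val]
  nlinarith [sq_nonneg (-174 * p - 35 * q + 95 * r + 158 * s),
    sq_nonneg (-20126 * p - 3153 * q + 28263 * r),
    sq_nonneg (-1185 * p + 6313 * q), sq_nonneg p]

theorem certA_valid : certA.Valid := by
  unfold Cert.Valid
  decide +kernel

theorem certB_valid : certB.Valid := by
  unfold Cert.Valid
  decide +kernel

/-- Degrees concentrate around `2n/5` when there are few independent quadruples. -/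
theorem sum_sq_degree_le {A : V → V → Bool}
    (hA : ∀ x y, A x y = A y x) (hT : ∀ x y z, (A x y && A x z && A y z) = false) :
    600 * (Fintype.card V : ℤ) ^ 5 +
      (Fintype.card V : ℤ) ^ 2 * ∑ x, (25 * ∑ y, bi (A x y) - 10 * (Fintype.card V : ℤ)) ^ 2 ≤
    5000 * (Fintype.card V * indepTuples A) := by
  have h := certA_valid.sum_dotTerm_le (fun a b c => by
    simp only [certA]
    nlinarith [sq_nonneg (3 * a - 2 * b), sq_nonneg b, sq_nonneg c]) hA hT
  have h2 := Finset.sum_le_sum fun x (_ : x ∈ Finset.univ) => sq_le_dotTerm_certA A x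
  simp only [mul_pow, ← Finset.mul_sum] at h2
  simp only [certA, zero_mul, add_zero] at h h2
  linarith

/-- There are many pentagons when there are few independent quadruples. -/
theorem le_pentagons {A : V → V → Bool}
    (hA : ∀ x y, A x y = A y x) (hT : ∀ x y z, (A x y && A x z && A y z) = false) :
    1510 * (Fintype.card V : ℤ) ^ 5 ≤
      12500 * (Fintype.card V * indepTuples A) + 30000 * pentagons A := by
  have h := certB_valid.sum_dotTerm_le (fun a b c => by
    simp only [certB]
    nlinarith [sq_nonneg (3 * a - 5 * b), sq_nonneg b, sq_nonneg c]) hA hT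
  have h2 := Finset.sum_nonneg fun x (_ : x ∈ Finset.univ) => dotTerm_certB_nonneg A x
  simp only [certB] at h h2
  linarith

end Certificates

section Structure

variable {V : Type*} [Fintype V] [DecidableEq V] (H : SimpleGraph V) [DecidableRel H.Adj]

/-- The points adjacent to both pentagon vertices next to `c i`. -/
def cell (c : Fin 5 → V) (i : Fin 5) : Finset V :=
  H.neighborFinset (c (i + 4)) ∩ H.neighborFinset (c (i + 1))

variable {H}

theorem mem_cell {c : Fin 5 → V} {i : Fin 5} {x : V} :
    x ∈ cell H c i ↔ H.Adj (c (i + 4)) x ∧ H.Adj (c (i + 1)) x := by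
  simp [cell]

theorem disjoint_cell (hH : ∀ x y z, H.Adj x y → H.Adj x z → ¬ H.Adj y z)
    {c : Fin 5 → V} (hc : ∀ i, H.Adj (c i) (c (i + 1))) {i j : Fin 5} (hij : i ≠ j) :
    Disjoint (cell H c i) (cell H c j) := by
  have hc' : ∀ k l : Fin 5, l = k + 1 → H.Adj (c k) (c l) := fun k l h => h ▸ hc k
  rw [Finset.disjoint_left]
  intro x hx hy
  rw [mem_cell] at hx hy
  have key : ∀ k l : Fin 5, l = k + 1 → H.Adj (c k) x → H.Adj (c l) x → False :=
    fun k l h hk hl => hH x _ _ hk.symm hl.symm (hc' k l h)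
  have hd : j = i + 1 ∨ j = i + 2 ∨ j = i + 3 ∨ j = i + 4 := by omega
  rcases hd with rfl | rfl | rfl | rfl
  · exact key (i + 1) (i + 1 + 1) rfl hx.2 hy.2
  · exact key (i + 2 + 1) (i + 4) (by omega) hy.2 hx.1
  · exact key (i + 1) (i + 3 + 4) (by omega) hx.2 hy.1
  · exact key (i + 4 + 4) (i + 4) (by omega) hy.1 hx.1

/-- Points of the same cell, or of cells at distance two, are not adjacent. -/
theorem not_adj_of_mem_cell (hH : ∀ x y z, H.Adj x y → H.Adj x z → ¬ H.Adj y z)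
    {c : Fin 5 → V} {i j : Fin 5} (hij : j = i ∨ j = i + 2 ∨ j = i + 3)
    {x y : V} (hx : x ∈ cell H c i) (hy : y ∈ cell H c j) : ¬ H.Adj x y := by
  rw [mem_cell] at hx hy
  rcases hij with rfl | rfl | rfl
  · exact hH _ _ _ hx.1 hy.1
  · have : i + 2 + 4 = i + 1 := by omega
    rw [this] at hy
    exact hH _ _ _ hx.2 hy.1
  · have : i + 3 + 1 = i + 4 := by omega
    rw [this] at hy
    exact hH _ _ _ hx.1 hy.2

/-- The points outside all cells. -/
def rest (H : SimpleGraph V) [DecidableRel H.Adj] (c : Fin 5 → V) : Finset V :=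
  Finset.univ.filter fun x => ∀ i, x ∉ cell H c i

theorem sum_degree_add_card_rest (hH : ∀ x y z, H.Adj x y → H.Adj x z → ¬ H.Adj y z)
    {c : Fin 5 → V} (hc : ∀ i, H.Adj (c i) (c (i + 1))) :
    ∑ i, H.degree (c i) + (rest H c).card ≤ 2 * Fintype.card V := by
  have h1 : ∀ i, H.degree (c i) = ∑ x, if H.Adj (c i) x then 1 else 0 := fun i => by
    rw [← Finset.card_filter, ← SimpleGraph.card_neighborFinset_eq_degree,
      SimpleGraph.neighborFinset_eq_filter]
  have h2 : (rest H c).card = ∑ x, if ∀ i, x ∉ cell H c i then 1 else 0 := by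
    rw [← Finset.card_filter, rest]
  simp only [h1, h2]
  rw [Finset.sum_comm, ← Finset.sum_add_distrib, mul_comm, ← smul_eq_mul, ← Finset.card_univ]
  refine Finset.sum_le_card_nsmul _ _ _ fun x _ => ?_
  have key : ∀ I : Finset (Fin 5), (∀ i ∈ I, i + 1 ∉ I) →
      I.card + (if ∀ i, ¬ (i + 4 ∈ I ∧ i + 1 ∈ I) then 1 else 0) ≤ 2 := by decide
  have := key (Finset.univ.filter fun i => H.Adj (c i) x) fun i hi hi' => by
    simp only [Finset.mem_filter, Finset.mem_univ, true_and] at hi hi'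
    exact hH x _ _ hi.symm hi'.symm (hc i)
  simp only [Finset.mem_filter, Finset.mem_univ, true_and] at this
  simpa only [Finset.card_filter, mem_cell] using this

theorem self_mem_cell {c : Fin 5 → V} (hc : ∀ i, H.Adj (c i) (c (i + 1))) (i : Fin 5) :
    c i ∈ cell H c i := by
  refine mem_cell.2 ⟨?_, (hc i).symm⟩
  simpa [add_assoc] using hc (i + 4)

theorem exists_mem_cell_of_notMem_rest {c : Fin 5 → V} {x : V} (hx : x ∉ rest H c) :
    ∃ i, x ∈ cell H c i := by
  simpa [rest] using hx

theorem neighborFinset_subset (hH : ∀ x y z, H.Adj x y → H.Adj x z → ¬ H.Adj y z)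
    {c : Fin 5 → V} {i : Fin 5} {x : V} (hx : x ∈ cell H c i) :
    H.neighborFinset x ⊆ cell H c (i + 4) ∪ cell H c (i + 1) ∪ rest H c := by
  intro y hy
  rw [SimpleGraph.mem_neighborFinset] at hy
  by_contra hcon
  simp only [Finset.mem_union, not_or] at hcon
  obtain ⟨j, hj⟩ := exists_mem_cell_of_notMem_rest hcon.2
  have h4 : j ≠ i + 4 := fun h => hcon.1.1 (h ▸ hj)
  have h1 : j ≠ i + 1 := fun h => hcon.1.2 (h ▸ hj)
  exact not_adj_of_mem_cell hH (by omega) hx hj hy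

theorem sum_card_cell_le (hH : ∀ x y z, H.Adj x y → H.Adj x z → ¬ H.Adj y z)
    {c : Fin 5 → V} (hc : ∀ i, H.Adj (c i) (c (i + 1))) :
    ∑ i, (cell H c i).card ≤ Fintype.card V := by
  rw [← Finset.card_biUnion fun i _ j _ hij => disjoint_cell hH hc hij]
  exact Finset.card_le_univ _

theorem sum_fin_five_shift (f : Fin 5 → ℝ) (i : Fin 5) :
    ∑ j, f j = f i + f (i + 1) + f (i + 2) + f (i + 3) + f (i + 4) := by
  rw [← Equiv.sum_comp (Equiv.addLeft i) f, Fin.sum_univ_five]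
  simp

theorem card_inter_cell_le (H : SimpleGraph V) [DecidableRel H.Adj] (c : Fin 5 → V) (x : V)
    (i : Fin 5) : ((H.neighborFinset x ∩ cell H c i).card : ℝ) ≤ (cell H c i).card := by
  exact_mod_cast Finset.card_le_card Finset.inter_subset_right

/-- A pentagon all of whose vertices have degree almost `2n/5`, in a triangle-free graph. -/
structure GoodPentagon (H : SimpleGraph V) [DecidableRel H.Adj] (c : Fin 5 → V) : Prop where
  triFree : ∀ x y z, H.Adj x y → H.Adj x z → ¬ H.Adj y z
  adj : ∀ i, H.Adj (c i) (c (i + 1))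
  le_degree : ∀ i, (2 / 5 - 1 / 10 ^ 6) * (Fintype.card V : ℝ) ≤ H.degree (c i)

namespace GoodPentagon

variable {c : Fin 5 → V} (h : GoodPentagon H c)
include h

theorem card_rest_le : ((rest H c).card : ℝ) ≤ 5 / 10 ^ 6 * Fintype.card V := by
  have h1 := sum_degree_add_card_rest h.triFree h.adj
  have h2 : (∑ i, (H.degree (c i) : ℝ)) + (rest H c).card ≤ 2 * Fintype.card V := by
    exact_mod_cast h1
  have h3 := Finset.sum_le_sum fun i (_ : i ∈ Finset.univ) => h.le_degree i
  rw [Finset.sum_const, Finset.card_univ, Fintype.card_fin, nsmul_eq_mul] at h3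
  push_cast at h3
  linarith

theorem degree_le_cells {i : Fin 5} {x : V} (hx : x ∈ cell H c i) :
    (H.degree x : ℝ) ≤ (H.neighborFinset x ∩ cell H c (i + 4)).card +
      (H.neighborFinset x ∩ cell H c (i + 1)).card + 5 / 10 ^ 6 * Fintype.card V := by
  have h1 : H.neighborFinset x ⊆ H.neighborFinset x ∩ cell H c (i + 4) ∪
      H.neighborFinset x ∩ cell H c (i + 1) ∪ rest H c := fun y hy => by
    have := neighborFinset_subset h.triFree hx hy
    simp only [Finset.mem_union, Finset.mem_inter] at this ⊢
    tauto
  have h2 := (Finset.card_le_card h1).trans (Finset.card_union_le _ _)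
  have h3 := Finset.card_union_le (H.neighborFinset x ∩ cell H c (i + 4))
    (H.neighborFinset x ∩ cell H c (i + 1))
  rw [SimpleGraph.card_neighborFinset_eq_degree] at h2
  have h4 := h.card_rest_le
  have h5 : (H.degree x : ℝ) ≤ (H.neighborFinset x ∩ cell H c (i + 4)).card +
      (H.neighborFinset x ∩ cell H c (i + 1)).card + (rest H c).card := by
    exact_mod_cast h2.trans (Nat.add_le_add_right h3 _)
  linarith

theorem le_cells (i : Fin 5) : (2 / 5 - 6 / 10 ^ 6) * (Fintype.card V : ℝ) ≤
    (cell H c (i + 4)).card + (cell H c (i + 1)).card := by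
  have h1 := h.degree_le_cells (self_mem_cell h.adj i)
  have h2 := h.le_degree i
  have h3 := card_inter_cell_le H c (c i) (i + 4)
  have h4 := card_inter_cell_le H c (c i) (i + 1)
  linarith

theorem card_cell_le (i : Fin 5) :
    ((cell H c i).card : ℝ) ≤ (1 / 5 + 12 / 10 ^ 6) * Fintype.card V := by
  have h1 : (∑ i, ((cell H c i).card : ℝ)) ≤ Fintype.card V := by
    exact_mod_cast sum_card_cell_le h.triFree h.adj
  rw [sum_fin_five_shift _ i] at h1
  have h2 := h.le_cells (i + 2)
  have h3 := h.le_cells (i + 3)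
  have e1 : i + 2 + 4 = i + 1 := by omega
  have e2 : i + 2 + 1 = i + 3 := by omega
  have e3 : i + 3 + 4 = i + 2 := by omega
  have e4 : i + 3 + 1 = i + 4 := by omega
  rw [e1, e2] at h2
  rw [e3, e4] at h3
  linarith

theorem le_card_cell (i : Fin 5) :
    (1 / 5 - 18 / 10 ^ 6) * (Fintype.card V : ℝ) ≤ (cell H c i).card := by
  have h1 := h.le_cells (i + 1)
  have h2 := h.card_cell_le (i + 2)
  have e1 : i + 1 + 4 = i := by omega
  have e2 : i + 1 + 1 = i + 2 := by omega
  rw [e1, e2] at h1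
  linarith

theorem card_sdiff_le {i j : Fin 5} (hij : j = i + 1 ∨ i = j + 1) {x : V} (hx : x ∈ cell H c i)
    (hd : (2 / 5 - 1 / 10 ^ 6) * (Fintype.card V : ℝ) ≤ H.degree x) :
    ((cell H c j).card : ℝ) - 30 / 10 ^ 6 * Fintype.card V ≤
      (H.neighborFinset x ∩ cell H c j).card := by
  have h1 := h.degree_le_cells hx
  have h2 := h.card_cell_le (i + 1)
  have h3 := h.card_cell_le (i + 4)
  have h4 := card_inter_cell_le H c x (i + 4)
  have h5 := card_inter_cell_le H c x (i + 1)
  have hj : j = i + 1 ∨ j = i + 4 := by omega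
  rcases hj with rfl | rfl <;> linarith

/-- No vertex has many neighbours in two consecutive cells. -/
theorem not_many {B : Finset V} (hB : (B.card : ℝ) ≤ 1 / 10 ^ 6 * Fintype.card V)
    (hB' : ∀ x ∉ B, (2 / 5 - 1 / 10 ^ 6) * (Fintype.card V : ℝ) ≤ H.degree x) (v : V) {i : Fin 5}
    (h1 : 31 / 10 ^ 6 * (Fintype.card V : ℝ) < (H.neighborFinset v ∩ cell H c i).card)
    (h2 : 31 / 10 ^ 6 * (Fintype.card V : ℝ) < (H.neighborFinset v ∩ cell H c (i + 1)).card) :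
    False := by
  have hn : (0 : ℝ) ≤ Fintype.card V := Nat.cast_nonneg _
  obtain ⟨w, hw, hwB⟩ : ∃ w ∈ H.neighborFinset v ∩ cell H c i, w ∉ B := by
    by_contra! hcon
    have : ((H.neighborFinset v ∩ cell H c i).card : ℝ) ≤ B.card := by
      exact_mod_cast Finset.card_le_card hcon
    linarith
  rw [Finset.mem_inter, SimpleGraph.mem_neighborFinset] at hw
  have h3 := h.card_sdiff_le (Or.inl rfl) hw.2 (hB' w hwB)
  obtain ⟨y, hy⟩ : ((H.neighborFinset v ∩ cell H c (i + 1)) ∩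
      (H.neighborFinset w ∩ cell H c (i + 1))).Nonempty := by
    rw [← Finset.card_pos]
    have h4 := Finset.card_union_add_card_inter (H.neighborFinset v ∩ cell H c (i + 1))
      (H.neighborFinset w ∩ cell H c (i + 1))
    have h5 : (H.neighborFinset v ∩ cell H c (i + 1) ∪
      H.neighborFinset w ∩ cell H c (i + 1)).card ≤ (cell H c (i + 1)).card :=
      Finset.card_le_card (Finset.union_subset Finset.inter_subset_right Finset.inter_subset_right)
    have h6 : (0 : ℝ) < ((H.neighborFinset v ∩ cell H c (i + 1)) ∩
      (H.neighborFinset w ∩ cell H c (i + 1))).card := by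
      have h4' := congrArg (Nat.cast (R := ℝ)) h4
      have h5' := (Nat.cast_le (α := ℝ)).2 h5
      push_cast at h4'
      linarith
    exact_mod_cast h6
  simp only [Finset.mem_inter, SimpleGraph.mem_neighborFinset] at hy
  exact h.triFree v w y hw.1 hy.1.1 hy.2.1

theorem exists_index {B : Finset V} (hB : (B.card : ℝ) ≤ 1 / 10 ^ 6 * Fintype.card V)
    (hB' : ∀ x ∉ B, (2 / 5 - 1 / 10 ^ 6) * (Fintype.card V : ℝ) ≤ H.degree x) (v : V) :
    ∃ i : Fin 5, ∀ j, j ≠ i + 1 → j ≠ i + 4 →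
      ((H.neighborFinset v ∩ cell H c j).card : ℝ) ≤ 31 / 10 ^ 6 * Fintype.card V := by
  classical
  have key : ∀ J : Finset (Fin 5), (∀ i ∈ J, i + 1 ∉ J) →
      ∃ i, ∀ j, j ≠ i + 1 → j ≠ i + 4 → j ∉ J := by decide
  obtain ⟨i, hi⟩ := key (Finset.univ.filter fun j =>
    31 / 10 ^ 6 * (Fintype.card V : ℝ) < (H.neighborFinset v ∩ cell H c j).card) fun i hi hi' =>
      h.not_many hB hB' v (Finset.mem_filter.1 hi).2 (Finset.mem_filter.1 hi').2
  refine ⟨i, fun j h1 h4 => ?_⟩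
  have := hi j h1 h4
  simpa using this

end GoodPentagon

/-- The ordered triples, repetitions allowed, forming an independent set together with `v`. -/
def indepTriples (H : SimpleGraph V) [DecidableRel H.Adj] (v : V) : Finset (V × V × V) :=
  Finset.univ.filter fun t => ¬ H.Adj v t.1 ∧ ¬ H.Adj v t.2.1 ∧ ¬ H.Adj v t.2.2 ∧
    ¬ H.Adj t.1 t.2.1 ∧ ¬ H.Adj t.1 t.2.2 ∧ ¬ H.Adj t.2.1 t.2.2

/-- The triples of cells around the cell `0` whose members are never adjacent and which avoid the
neighbouring cells `1` and `4`. -/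
def mainWords : Finset (Fin 5 × Fin 5 × Fin 5) :=
  ({0, 2} ×ˢ {0, 2} ×ˢ {0, 2}) ∪ ({0, 3} ×ˢ {0, 3} ×ˢ {0, 3})

def words : Finset (Fin 5 × Fin 5 × Fin 5) := mainWords ∪ {(4, 2, 2), (1, 3, 3)}

theorem sum_words_le (hH : ∀ x y z, H.Adj x y → H.Adj x z → ¬ H.Adj y z)
    {c : Fin 5 → V} (hc : ∀ i, H.Adj (c i) (c (i + 1))) (v : V) (i : Fin 5) :
    ∑ w ∈ words, (cell H c (i + w.1) \ H.neighborFinset v).card *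
      ((cell H c (i + w.2.1) \ H.neighborFinset v).card *
        (cell H c (i + w.2.2) \ H.neighborFinset v).card) ≤ (indepTriples H v).card := by
  simp only [← Finset.card_product]
  rw [← Finset.card_biUnion]
  · refine Finset.card_le_card fun t ht => ?_
    simp only [Finset.mem_biUnion, Finset.mem_product, Finset.mem_sdiff,
      SimpleGraph.mem_neighborFinset] at ht
    obtain ⟨w, hw, ⟨h0, h0'⟩, ⟨h1, h1'⟩, h2, h2'⟩ := ht
    have key : ∀ w ∈ words,
        (w.2.1 = w.1 ∨ w.2.1 = w.1 + 2 ∨ w.2.1 = w.1 + 3) ∧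
        (w.2.2 = w.1 ∨ w.2.2 = w.1 + 2 ∨ w.2.2 = w.1 + 3) ∧
        (w.2.2 = w.2.1 ∨ w.2.2 = w.2.1 + 2 ∨ w.2.2 = w.2.1 + 3) := by decide +kernel
    obtain ⟨k1, k2, k3⟩ := key w hw
    simp only [indepTriples, Finset.mem_filter, Finset.mem_univ, true_and]
    exact ⟨h0', h1', h2', not_adj_of_mem_cell hH (by omega) h0 h1,
      not_adj_of_mem_cell hH (by omega) h0 h2, not_adj_of_mem_cell hH (by omega) h1 h2⟩
  · intro w _ w' _ hww
    rw [Function.onFun, Finset.disjoint_left]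
    rintro t ht ht'
    simp only [Finset.mem_product, Finset.mem_sdiff] at ht ht'
    have key : ∀ a b : Fin 5, ∀ x, x ∈ cell H c (i + a) → x ∈ cell H c (i + b) → a = b := by
      intro a b x ha hb
      by_contra hab
      exact Finset.disjoint_left.1 (disjoint_cell hH hc (i := i + a) (j := i + b) (by omega)) ha hb
    exact hww (Prod.ext (key _ _ _ ht.1.1 ht'.1.1)
      (Prod.ext (key _ _ _ ht.2.1.1 ht'.2.1.1) (key _ _ _ ht.2.2.1 ht'.2.2.1)))

theorem sum_words_ge (x : Fin 5 → ℝ) (m : ℝ) (hm : 0 ≤ m) (hx : ∀ j, 0 ≤ x j)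
    (h0 : m ≤ x 0) (h2 : m ≤ x 2) (h3 : m ≤ x 3) :
    15 * m ^ 3 + (x 1 + x 4) * m ^ 2 ≤ ∑ w ∈ words, x w.1 * (x w.2.1 * x w.2.2) := by
  have hd : Disjoint mainWords {(4, 2, 2), (1, 3, 3)} := by decide
  have hcard : mainWords.card = 15 := by decide
  have hmem : ∀ w ∈ mainWords, (w.1 = 0 ∨ w.1 = 2 ∨ w.1 = 3) ∧
      (w.2.1 = 0 ∨ w.2.1 = 2 ∨ w.2.1 = 3) ∧ (w.2.2 = 0 ∨ w.2.2 = 2 ∨ w.2.2 = 3) := by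
    decide +kernel
  have hge : ∀ j, (j = 0 ∨ j = 2 ∨ j = 3) → m ≤ x j := by
    rintro j (rfl | rfl | rfl) <;> assumption
  rw [words, Finset.sum_union hd, Finset.sum_pair (by decide)]
  have h1 : mainWords.card • (m * (m * m)) ≤ ∑ w ∈ mainWords, x w.1 * (x w.2.1 * x w.2.2) := by
    refine Finset.card_nsmul_le_sum _ _ _ fun w hw => ?_
    obtain ⟨a, b, d⟩ := hmem w hw
    exact mul_le_mul (hge _ a) (mul_le_mul (hge _ b) (hge _ d) hm (hx _)) (mul_nonneg hm hm) (hx _)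
  rw [hcard, nsmul_eq_mul] at h1
  have h4 := mul_le_mul_of_nonneg_left (mul_le_mul h2 h2 hm (hx _)) (hx 4)
  have h5 := mul_le_mul_of_nonneg_left (mul_le_mul h3 h3 hm (hx _)) (hx 1)
  push_cast at h1
  simp only
  linarith

namespace GoodPentagon

variable {c : Fin 5 → V} (h : GoodPentagon H c)
include h

/-- If `v` lies in few independent quadruples, it is adjacent to almost all points of two cells at
distance two. -/
theorem exists_index_sdiff {B : Finset V} (hB : (B.card : ℝ) ≤ 1 / 10 ^ 6 * Fintype.card V)
    (hB' : ∀ x ∉ B, (2 / 5 - 1 / 10 ^ 6) * (Fintype.card V : ℝ) ≤ H.degree x) {v : V}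
    (hv : ((indepTriples H v).card : ℝ) ≤ (3 / 25 + 1 / 10 ^ 6) * (Fintype.card V : ℝ) ^ 3) :
    ∃ i : Fin 5, ((cell H c (i + 1) \ H.neighborFinset v).card : ℝ) +
      (cell H c (i + 4) \ H.neighborFinset v).card ≤ 1 / 20 * Fintype.card V := by
  obtain ⟨i, hi⟩ := h.exists_index hB hB' v
  refine ⟨i, ?_⟩
  have hn : (0 : ℝ) < Fintype.card V := by exact_mod_cast Fintype.card_pos_iff.2 ⟨v⟩
  have hm : ∀ j, j ≠ i + 1 → j ≠ i + 4 → (1 / 5 - 49 / 10 ^ 6) * (Fintype.card V : ℝ) ≤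
      (cell H c j \ H.neighborFinset v).card := fun j h1 h4 => by
    have h5 := hi j h1 h4
    have h6 := h.le_card_cell j
    have h7 := Finset.card_sdiff_add_card_inter (cell H c j) (H.neighborFinset v)
    rw [Finset.inter_comm] at h7
    have h7' := congrArg (Nat.cast (R := ℝ)) h7
    push_cast at h7'
    linarith
  have h1 := sum_words_ge (fun j => ((cell H c (i + j) \ H.neighborFinset v).card : ℝ))
    ((1 / 5 - 49 / 10 ^ 6) * (Fintype.card V : ℝ)) (by positivity) (fun j => by positivity)
    (hm _ (by omega) (by omega)) (hm _ (by omega) (by omega)) (hm _ (by omega) (by omega))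
  have h2 : (∑ w ∈ words, ((cell H c (i + w.1) \ H.neighborFinset v).card : ℝ) *
      ((cell H c (i + w.2.1) \ H.neighborFinset v).card *
        (cell H c (i + w.2.2) \ H.neighborFinset v).card)) ≤ (indepTriples H v).card := by
    exact_mod_cast sum_words_le h.triFree h.adj v i
  have h3 := (h1.trans h2).trans hv
  by_contra! hcon
  have h4 : 1 / 20 * (Fintype.card V : ℝ) * (1 / 26 * (Fintype.card V : ℝ) ^ 2) ≤
      (((cell H c (i + 1) \ H.neighborFinset v).card : ℝ) +
      (cell H c (i + 4) \ H.neighborFinset v).card) *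
      ((1 / 5 - 49 / 10 ^ 6) * (Fintype.card V : ℝ)) ^ 2 := by
    refine mul_le_mul hcon.le ?_ (by positivity) (by positivity)
    nlinarith [sq_nonneg (Fintype.card V : ℝ)]
  have h5 : (0 : ℝ) < (Fintype.card V : ℝ) ^ 3 := by positivity
  have h6 : 1 / 20 * (Fintype.card V : ℝ) * (1 / 26 * (Fintype.card V : ℝ) ^ 2) =
    1 / 520 * (Fintype.card V : ℝ) ^ 3 := by ring
  have h7 : 15 * ((1 / 5 - 49 / 10 ^ 6) * (Fintype.card V : ℝ)) ^ 3 =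
    15 * (1 / 5 - 49 / 10 ^ 6) ^ 3 * (Fintype.card V : ℝ) ^ 3 := by ring
  rw [h6] at h4
  rw [h7] at h3
  norm_num at h3
  norm_num at h4
  linarith

/-- The graph is contained in a blow-up of the pentagon with nearly equal parts. -/
theorem exists_parts {B : Finset V} (hB : (B.card : ℝ) ≤ 1 / 10 ^ 6 * Fintype.card V)
    (hB' : ∀ x ∉ B, (2 / 5 - 1 / 10 ^ 6) * (Fintype.card V : ℝ) ≤ H.degree x)
    (hv : ∀ v, ((indepTriples H v).card : ℝ) ≤
      (3 / 25 + 1 / 10 ^ 6) * (Fintype.card V : ℝ) ^ 3) :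
    ∃ Q : V → Fin 5, (∀ x y, H.Adj x y → Q y = Q x + 1 ∨ Q x = Q y + 1) ∧
      ∀ j, (1 / 5 - 18 / 10 ^ 6) * (Fintype.card V : ℝ) ≤
        (Finset.univ.filter fun x => Q x = j).card := by
  choose Q hQ using fun v => h.exists_index_sdiff hB hB' (hv v)
  have half : ∀ v j, (j = Q v + 1 ∨ j = Q v + 4) →
      ((cell H c j \ H.neighborFinset v).card : ℝ) ≤ 1 / 20 * Fintype.card V := by
    intro v j hj
    have h1 := hQ v
    have h2 : (0 : ℝ) ≤ (cell H c (Q v + 1) \ H.neighborFinset v).card := Nat.cast_nonneg _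
    have h3 : (0 : ℝ) ≤ (cell H c (Q v + 4) \ H.neighborFinset v).card := Nat.cast_nonneg _
    rcases hj with rfl | rfl <;> linarith
  have common : ∀ v w j, (j = Q v + 1 ∨ j = Q v + 4) → (j = Q w + 1 ∨ j = Q w + 4) →
      ∃ y ∈ cell H c j, H.Adj v y ∧ H.Adj w y := by
    intro v w j hv hw
    have hn : (0 : ℝ) < Fintype.card V := by exact_mod_cast Fintype.card_pos_iff.2 ⟨v⟩
    by_contra! hcon
    have h1 : cell H c j ⊆ cell H c j \ H.neighborFinset v ∪ cell H c j \ H.neighborFinset w := by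
      intro y hy
      have := hcon y hy
      simp only [Finset.mem_union, Finset.mem_sdiff, SimpleGraph.mem_neighborFinset]
      tauto
    have h2 : ((cell H c j).card : ℝ) ≤ (cell H c j \ H.neighborFinset v).card +
        (cell H c j \ H.neighborFinset w).card := by
      exact_mod_cast (Finset.card_le_card h1).trans (Finset.card_union_le _ _)
    have h3 := half v j hv
    have h4 := half w j hw
    have h5 := h.le_card_cell j
    linarith
  refine ⟨Q, fun x y hxy => ?_, fun j => (h.le_card_cell j).trans ?_⟩
  · by_contra hcon
    obtain ⟨j, hj, hj'⟩ : ∃ j : Fin 5,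
        (j = Q x + 1 ∨ j = Q x + 4) ∧ (j = Q y + 1 ∨ j = Q y + 4) := by
      have key : ∀ a b : Fin 5, ¬ (b = a + 1 ∨ a = b + 1) →
          ∃ j, (j = a + 1 ∨ j = a + 4) ∧ (j = b + 1 ∨ j = b + 4) := by decide
      exact key _ _ hcon
    obtain ⟨z, -, hz, hz'⟩ := common x y j hj hj'
    exact h.triFree z x y hz.symm hz'.symm hxy
  · rw [Nat.cast_le]
    refine Finset.card_le_card fun x hx => ?_
    rw [Finset.mem_filter]
    refine ⟨Finset.mem_univ _, ?_⟩
    by_contra hcon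
    obtain ⟨l, hl, hl'⟩ : ∃ l : Fin 5, (l = Q x + 1 ∨ l = Q x + 4) ∧
        (l = j ∨ l = j + 2 ∨ l = j + 3) := by
      have key : ∀ a j : Fin 5, ¬ a = j →
          ∃ l, (l = a + 1 ∨ l = a + 4) ∧ (l = j ∨ l = j + 2 ∨ l = j + 3) := by decide
      exact key _ _ hcon
    obtain ⟨y, hy, hy', -⟩ := common x x l hl hl
    exact not_adj_of_mem_cell h.triFree hl' hx hy hy'

end GoodPentagon

end Structure

section Pentagon

variable {V : Type*} [Fintype V] [DecidableEq V] {H : SimpleGraph V} [DecidableRel H.Adj]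

theorem bi_decide (p : Prop) [Decidable p] : bi (decide p) = if p then 1 else 0 := by
  by_cases h : p <;> simp [bi, h]

omit [DecidableEq V] in
theorem sum_bi_adj (x : V) : ∑ y, bi (decide (H.Adj x y)) = H.degree x := by
  simp only [bi_decide]
  rw [← Finset.sum_filter, Finset.sum_const, ← SimpleGraph.neighborFinset_eq_filter,
    SimpleGraph.card_neighborFinset_eq_degree]
  simp

omit [DecidableEq V] in
/-- Few points have degree well below `2n/5`. -/
theorem card_low_degree_le (hH : ∀ x y z, H.Adj x y → H.Adj x z → ¬ H.Adj y z)
    (hI : (indepTuples (fun x y => decide (H.Adj x y)) : ℝ) ≤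
      3 / 25 * (Fintype.card V : ℝ) ^ 4 + 100 * (Fintype.card V : ℝ) ^ 3) :
    ((Finset.univ.filter fun x =>
      (H.degree x : ℝ) < (2 / 5 - 1 / 10 ^ 6) * (Fintype.card V : ℝ)).card : ℝ) ≤ 10 ^ 15 := by
  rcases isEmpty_or_nonempty V with hV | hV
  · simp
  have hn : (0 : ℝ) < Fintype.card V := by exact_mod_cast Fintype.card_pos
  have h1 := sum_sq_degree_le (A := fun x y => decide (H.Adj x y))
    (fun x y => by simp [H.adj_comm]) (fun x y z => by simpa using hH x y z)
  simp only [sum_bi_adj] at h1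
  have h2 := (Int.cast_le (R := ℝ)).2 h1
  push_cast at h2
  set n : ℝ := (Fintype.card V : ℝ)
  set B := Finset.univ.filter fun x => (H.degree x : ℝ) < (2 / 5 - 1 / 10 ^ 6) * n
  have h3 : B.card • (25 / 10 ^ 6 * n) ^ 2 ≤ ∑ x ∈ B, (25 * (H.degree x : ℝ) - 10 * n) ^ 2 := by
    refine Finset.card_nsmul_le_sum _ _ _ fun x hx => ?_
    have h4 := (Finset.mem_filter.1 hx).2
    have h5 : 25 / 10 ^ 6 * n ≤ 10 * n - 25 * H.degree x := by linarith
    have h6 := pow_le_pow_left₀ (by positivity) h5 2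
    linarith [h6]
  have h4 : ∑ x ∈ B, (25 * (H.degree x : ℝ) - 10 * n) ^ 2 ≤
      ∑ x, (25 * (H.degree x : ℝ) - 10 * n) ^ 2 :=
    Finset.sum_le_sum_of_subset_of_nonneg (Finset.filter_subset _ _) fun _ _ _ => sq_nonneg _
  rw [nsmul_eq_mul] at h3
  have h5 := mul_le_mul_of_nonneg_left (h3.trans h4) (sq_nonneg n)
  have h6 := mul_le_mul_of_nonneg_left hI hn.le
  have h7 : (B.card : ℝ) * n ^ 4 ≤ 10 ^ 15 * n ^ 4 := by
    nlinarith [pow_pos hn 4]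
  exact le_of_mul_le_mul_right h7 (by positivity)

omit [DecidableEq V] in
theorem exists_goodPentagon (hH : ∀ x y z, H.Adj x y → H.Adj x z → ¬ H.Adj y z)
    (hI : (indepTuples (fun x y => decide (H.Adj x y)) : ℝ) ≤
      3 / 25 * (Fintype.card V : ℝ) ^ 4 + 100 * (Fintype.card V : ℝ) ^ 3)
    (hn : (10 : ℝ) ^ 24 ≤ Fintype.card V) : ∃ c, GoodPentagon H c := by
  have h1 := le_pentagons (A := fun x y => decide (H.Adj x y))
    (fun x y => by simp [H.adj_comm]) (fun x y z => by simpa using hH x y z)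
  have h2 := (Int.cast_le (R := ℝ)).2 h1
  push_cast at h2
  by_contra hcon
  let L : V → Prop := fun x => (H.degree x : ℝ) < (2 / 5 - 1 / 10 ^ 6) * (Fintype.card V : ℝ)
  have hB : ((Finset.univ.filter L).card : ℝ) ≤ 10 ^ 15 := card_low_degree_le hH hI
  have h3 : pentagons (fun x y => decide (H.Adj x y)) ≤ ∑ x, ∑ y, ∑ z, ∑ u, ∑ w,
      (bi (decide (L x)) + bi (decide (L y)) + bi (decide (L z)) + bi (decide (L u))
        + bi (decide (L w))) := by
    refine Finset.sum_le_sum fun x _ => Finset.sum_le_sum fun y _ => Finset.sum_le_sum fun z _ =>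
      Finset.sum_le_sum fun u _ => Finset.sum_le_sum fun w _ => ?_
    have hx := bi_nonneg (decide (L x))
    have hy := bi_nonneg (decide (L y))
    have hz := bi_nonneg (decide (L z))
    have hu := bi_nonneg (decide (L u))
    have hw := bi_nonneg (decide (L w))
    by_cases hp : H.Adj x y ∧ H.Adj y z ∧ H.Adj z u ∧ H.Adj u w ∧ H.Adj x w
    · have hL : L x ∨ L y ∨ L z ∨ L u ∨ L w := by
        by_contra! hL
        refine hcon ⟨![x, y, z, u, w], hH, ?_, ?_⟩
        · intro i
          fin_cases i
          · exact hp.1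
          · exact hp.2.1
          · exact hp.2.2.1
          · exact hp.2.2.2.1
          · exact hp.2.2.2.2.symm
        · intro i
          fin_cases i
          · exact not_lt.1 hL.1
          · exact not_lt.1 hL.2.1
          · exact not_lt.1 hL.2.2.1
          · exact not_lt.1 hL.2.2.2.1
          · exact not_lt.1 hL.2.2.2.2
      have h1 : ∀ b, bi b ≤ 1 := by decide
      have h2 : ∀ v, L v → bi (decide (L v)) = 1 := fun v hv => by
        rw [decide_eq_true hv]
        rfl
      refine (h1 _).trans ?_
      rcases hL with h | h | h | h | h <;> rw [h2 _ h] <;> linarith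
    · have : (decide (H.Adj x y) && decide (H.Adj y z) && decide (H.Adj z u) && decide (H.Adj u w)
          && decide (H.Adj x w)) = false := by
        simp only [Bool.and_eq_false_iff, decide_eq_false_iff_not]
        tauto
      rw [this, show bi false = 0 from rfl]
      linarith
  have h4 : ∑ x, bi (decide (L x)) = (Finset.univ.filter L).card := by
    simp [bi_decide, Finset.sum_boole]
  simp only [Finset.sum_add_distrib, Finset.sum_const, Finset.card_univ, nsmul_eq_mul,
    ← Finset.mul_sum, h4] at h3
  have h5 := (Int.cast_le (R := ℝ)).2 h3
  push_cast at h5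
  set n : ℝ := (Fintype.card V : ℝ)
  have hn0 : (0 : ℝ) < n := lt_of_lt_of_le (by positivity) hn
  have h6 := mul_le_mul_of_nonneg_left hI hn0.le
  have h7 : (pentagons (fun x y => decide (H.Adj x y)) : ℝ) ≤ 5 * 10 ^ 15 * n ^ 4 := by
    have := mul_le_mul_of_nonneg_right hB (by positivity : (0 : ℝ) ≤ n ^ 4)
    refine h5.trans ?_
    nlinarith
  have h8 : 10 * n ^ 5 ≤ 10 ^ 23 * n ^ 4 := by nlinarith [pow_pos hn0 4]
  nlinarith [pow_pos hn0 4]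

theorem exists_parts_of_few (hH : ∀ x y z, H.Adj x y → H.Adj x z → ¬ H.Adj y z)
    (hI : (indepTuples (fun x y => decide (H.Adj x y)) : ℝ) ≤
      3 / 25 * (Fintype.card V : ℝ) ^ 4 + 100 * (Fintype.card V : ℝ) ^ 3)
    (hv : ∀ v, ((indepTriples H v).card : ℝ) ≤
      (3 / 25 + 1 / 10 ^ 6) * (Fintype.card V : ℝ) ^ 3)
    (hn : (10 : ℝ) ^ 24 ≤ Fintype.card V) :
    ∃ Q : V → Fin 5, (∀ x y, H.Adj x y → Q y = Q x + 1 ∨ Q x = Q y + 1) ∧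
      ∀ j, (1 / 5 - 18 / 10 ^ 6) * (Fintype.card V : ℝ) ≤
        (Finset.univ.filter fun x => Q x = j).card := by
  obtain ⟨c, hc⟩ := exists_goodPentagon hH hI hn
  refine hc.exists_parts (B := Finset.univ.filter fun x =>
    (H.degree x : ℝ) < (2 / 5 - 1 / 10 ^ 6) * (Fintype.card V : ℝ)) ?_ (fun x hx => ?_) hv
  · linarith [card_low_degree_le hH hI]
  · simpa using hx

end Pentagon

section Cliques

variable {V : Type*} [Fintype V] [DecidableEq V]

theorem cliqueCount_eq_card_cliqueFinset (G : SimpleGraph V) [DecidableRel G.Adj] (k : ℕ) :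
    cliqueCount G k = (G.cliqueFinset k).card := by
  rw [cliqueCount, Nat.card_eq_fintype_card, Fintype.card_subtype]
  congr 1
  ext s
  simp [SimpleGraph.isNClique_iff, and_comm]

/-- The 4-cliques containing `v`. -/
def cliquesAt (G : SimpleGraph V) [DecidableRel G.Adj] (v : V) : Finset (Finset V) :=
  (G.cliqueFinset 4).filter (v ∈ ·)

theorem mem_cliquesAt {G : SimpleGraph V} [DecidableRel G.Adj] {v : V} {s : Finset V} :
    s ∈ cliquesAt G v ↔ G.IsNClique 4 s ∧ v ∈ s := by
  simp [cliquesAt]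

theorem sum_card_cliquesAt (G : SimpleGraph V) [DecidableRel G.Adj] :
    ∑ v, (cliquesAt G v).card = 4 * (G.cliqueFinset 4).card := by
  simp only [cliquesAt, Finset.card_filter]
  rw [Finset.sum_comm, mul_comm, ← smul_eq_mul, ← Finset.sum_const]
  refine Finset.sum_congr rfl fun s hs => ?_
  rw [← Finset.card_filter]
  simpa using (G.mem_cliqueFinset_iff.1 hs).card_eq

theorem card_indepTriples_le (G : SimpleGraph V) [DecidableRel G.Adj] (v : V) :
    (indepTriples Gᶜ v).card ≤ 6 * (cliquesAt G v).card + 6 * Fintype.card V ^ 2 := by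
  set S := indepTriples Gᶜ v
  let bad : V × V × V → Prop := fun t =>
    t.1 = v ∨ t.2.1 = v ∨ t.2.2 = v ∨ t.1 = t.2.1 ∨ t.1 = t.2.2 ∨ t.2.1 = t.2.2
  rw [← Finset.card_filter_add_card_filter_not (s := S) (fun t => ¬ bad t)]
  refine Nat.add_le_add ?_ ?_
  · have hf : ∀ t ∈ S.filter (fun t => ¬ bad t),
        ({v, t.1, t.2.1, t.2.2} : Finset V) ∈ cliquesAt G v := by
      rintro ⟨x, y, z⟩ ht
      simp only [S, bad, indepTriples, Finset.mem_filter, Finset.mem_univ, true_and,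
        SimpleGraph.compl_adj, not_and, not_not, not_or] at ht
      obtain ⟨⟨h1, h2, h3, h4, h5, h6⟩, k1, k2, k3, k4, k5, k6⟩ := ht
      have h1 := h1 (Ne.symm k1)
      have h2 := h2 (Ne.symm k2)
      have h3 := h3 (Ne.symm k3)
      have h4 := h4 k4
      have h5 := h5 k5
      have h6 := h6 k6
      refine mem_cliquesAt.2 ⟨⟨?_, ?_⟩, Finset.mem_insert_self _ _⟩
      · intro a ha b hb hab
        simp only [Finset.coe_insert, Finset.coe_singleton, Set.mem_insert_iff,
          Set.mem_singleton_iff] at ha hb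
        rcases ha with rfl | rfl | rfl | rfl <;> rcases hb with rfl | rfl | rfl | rfl <;>
          first
            | exact absurd rfl hab
            | assumption
            | (apply SimpleGraph.Adj.symm; assumption)
      · have k1' := Ne.symm k1
        have k2' := Ne.symm k2
        have k3' := Ne.symm k3
        simp [k1', k2', k3', k4, k5, k6]
    refine Finset.card_le_mul_card_image_of_maps_to hf 6 fun s hs => ?_
    rcases Finset.eq_empty_or_nonempty ({t ∈ S.filter (fun t => ¬ bad t) |
      ({v, t.1, t.2.1, t.2.2} : Finset V) = s}) with h | ⟨⟨a, b, c⟩, h⟩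
    · simp [h]
    · refine (Finset.card_le_card (t := {(a, b, c), (a, c, b), (b, a, c), (b, c, a), (c, a, b),
        (c, b, a)}) ?_).trans Finset.card_le_six
      rintro ⟨x, y, z⟩ ht
      simp only [bad, Finset.mem_filter, not_or] at h ht
      obtain ⟨⟨-, k1, k2, k3, k4, k5, k6⟩, he⟩ := ht
      obtain ⟨-, he'⟩ := h
      have hx : x ∈ s := he ▸ by simp
      have hy : y ∈ s := he ▸ by simp
      have hz : z ∈ s := he ▸ by simp
      rw [← he'] at hx hy hz
      simp only [Finset.mem_insert, Finset.mem_singleton, k1, k2, k3, false_or] at hx hy hz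
      simp only [Finset.mem_insert, Finset.mem_singleton, Prod.mk.injEq]
      rcases hx with rfl | rfl | rfl <;> rcases hy with rfl | rfl | rfl <;>
        rcases hz with rfl | rfl | rfl <;> simp_all
  · have h : S.filter (fun t => ¬ ¬ bad t) ⊆
        (Finset.univ.image fun p : V × V => (v, p.1, p.2)) ∪
        ((Finset.univ.image fun p : V × V => (p.1, v, p.2)) ∪
        ((Finset.univ.image fun p : V × V => (p.1, p.2, v)) ∪
        ((Finset.univ.image fun p : V × V => (p.1, p.1, p.2)) ∪
        ((Finset.univ.image fun p : V × V => (p.1, p.2, p.1)) ∪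
        (Finset.univ.image fun p : V × V => (p.1, p.2, p.2)))))) := by
      rintro ⟨x, y, z⟩ ht
      have := (Finset.mem_filter.1 ht).2
      simp only [not_not, bad] at this
      simp only [Finset.mem_union, Finset.mem_image, Finset.mem_univ, true_and, Prod.exists,
        Prod.mk.injEq]
      rcases this with h | h | h | h | h | h <;> subst h <;> simp
    have hc : ∀ f : V × V → V × V × V, (Finset.univ.image f).card ≤ Fintype.card V ^ 2 := fun f =>
      Finset.card_image_le.trans (by simp [sq])
    refine (Finset.card_le_card h).trans ?_
    refine (Finset.card_union_le _ _).trans ?_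
    refine (Nat.add_le_add (hc _) ((Finset.card_union_le _ _).trans (Nat.add_le_add (hc _)
      ((Finset.card_union_le _ _).trans (Nat.add_le_add (hc _)
      ((Finset.card_union_le _ _).trans (Nat.add_le_add (hc _)
      ((Finset.card_union_le _ _).trans (Nat.add_le_add (hc _) (hc _)))))))))).trans ?_
    omega

omit [DecidableEq V] in
theorem indepTuples_eq (H : SimpleGraph V) [DecidableRel H.Adj] :
    indepTuples (fun x y => decide (H.Adj x y)) = ∑ v, ((indepTriples H v).card : ℤ) := by
  refine Finset.sum_congr rfl fun v _ => ?_
  rw [indepTriples, Finset.card_filter, Fintype.sum_prod_type]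
  push_cast
  refine Finset.sum_congr rfl fun y _ => ?_
  rw [Fintype.sum_prod_type]
  refine Finset.sum_congr rfl fun z _ => Finset.sum_congr rfl fun u _ => ?_
  simp only [← decide_not, ← Bool.decide_and, bi_decide, and_assoc]

theorem indepTuples_compl_le (G : SimpleGraph V) [DecidableRel G.Adj] :
    indepTuples (fun x y => decide (Gᶜ.Adj x y)) ≤
      24 * ((G.cliqueFinset 4).card : ℤ) + 6 * (Fintype.card V : ℤ) ^ 3 := by
  rw [indepTuples_eq]
  have h1 := Finset.sum_le_sum fun v (_ : v ∈ Finset.univ) => card_indepTriples_le G v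
  rw [Finset.sum_add_distrib, ← Finset.mul_sum, sum_card_cliquesAt, Finset.sum_const,
    Finset.card_univ, smul_eq_mul] at h1
  have h2 := (Nat.cast_le (α := ℤ)).2 h1
  push_cast at h2
  linarith

/-- The graph obtained from `G` by replacing `v` with a twin of `u`. -/
def twin (G : SimpleGraph V) (u v : V) : SimpleGraph V where
  Adj x y := x ≠ y ∧ (Function.update id v u x = Function.update id v u y ∨
    G.Adj (Function.update id v u x) (Function.update id v u y))
  symm := ⟨fun _ _ h => ⟨h.1.symm, h.2.imp Eq.symm SimpleGraph.Adj.symm⟩⟩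
  loopless := ⟨fun _ h => h.1 rfl⟩

omit [Fintype V] in
theorem indepBound_twin {G : SimpleGraph V} {m : ℕ} (hG : IndepBound G m) (u v : V) :
    IndepBound (twin G u v) m := by
  intro s hs
  have hinj : Set.InjOn (Function.update id v u) (s : Set V) := by
    intro x hx y hy hxy
    by_contra hne
    exact hs x hx y hy hne ⟨hne, Or.inl hxy⟩
  rw [← Finset.card_image_of_injOn hinj]
  refine hG _ fun a ha b hb hab hadj => ?_
  obtain ⟨x, hx, rfl⟩ := Finset.mem_image.1 ha
  obtain ⟨y, hy, rfl⟩ := Finset.mem_image.1 hb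
  exact hs x hx y hy (fun h => hab (h ▸ rfl)) ⟨fun h => hab (h ▸ rfl), Or.inr hadj⟩

theorem card_cliqueFinset_twin_le (G : SimpleGraph V) [DecidableRel G.Adj] {u v : V}
    (huv : u ≠ v) [DecidableRel (twin G u v).Adj] :
    ((twin G u v).cliqueFinset 4).card + (cliquesAt G v).card ≤
      (G.cliqueFinset 4).card + (cliquesAt G u).card + Fintype.card V ^ 2 := by
  set T := (twin G u v).cliqueFinset 4
  have h1 : T.filter (v ∉ ·) ⊆ (G.cliqueFinset 4).filter (v ∉ ·) := by
    intro s hs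
    simp only [T, Finset.mem_filter, SimpleGraph.mem_cliqueFinset_iff] at hs ⊢
    refine ⟨⟨fun x hx y hy hxy => ?_, hs.1.2⟩, hs.2⟩
    have := (hs.1.1 hx hy hxy).2
    rw [Function.update_of_ne (ne_of_mem_of_not_mem hx hs.2),
      Function.update_of_ne (ne_of_mem_of_not_mem hy hs.2)] at this
    exact this.resolve_left hxy
  have h2 : (T.filter fun s => v ∈ s ∧ u ∉ s).card ≤ (cliquesAt G u).card := by
    refine Finset.card_le_card_of_injOn (fun s => insert u (s.erase v)) ?_ ?_
    · intro s hs
      simp only [T, Finset.coe_filter, SimpleGraph.mem_cliqueFinset_iff, Set.mem_ofPred_eq] at hs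
      obtain ⟨⟨hs1, hs2⟩, hv, hu⟩ := hs
      have hadj : ∀ x ∈ s, x ≠ v → G.Adj u x := by
        intro x hx hxv
        have := (hs1 hv hx hxv.symm).2
        rw [Function.update_self, Function.update_of_ne hxv] at this
        exact this.resolve_left fun h => hu (h ▸ hx)
      refine Finset.mem_coe.2 (mem_cliquesAt.2 ⟨⟨?_, ?_⟩, Finset.mem_insert_self _ _⟩)
      · rw [Finset.coe_insert, SimpleGraph.isClique_insert]
        refine ⟨fun x hx y hy hxy => ?_, fun x hx hux => ?_⟩
        · have hx := Finset.mem_erase.1 hx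
          have hy := Finset.mem_erase.1 hy
          have := (hs1 hx.2 hy.2 hxy).2
          rw [Function.update_of_ne hx.1, Function.update_of_ne hy.1] at this
          exact this.resolve_left hxy
        · have hx := Finset.mem_erase.1 hx
          exact hadj x hx.2 hx.1
      · rw [Finset.card_insert_of_notMem fun h => hu (Finset.mem_of_mem_erase h),
          Finset.card_erase_of_mem hv, hs2]
    · intro s hs t ht hst
      simp only [Finset.coe_filter, Set.mem_ofPred_eq] at hs ht
      have e : ∀ r : Finset V, v ∈ r → u ∉ r → insert v ((insert u (r.erase v)).erase u) = r := by
        intro r hv hu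
        rw [Finset.erase_insert fun h => hu (Finset.mem_of_mem_erase h), Finset.insert_erase hv]
      rw [← e s hs.2.1 hs.2.2, ← e t ht.2.1 ht.2.2]
      exact congrArg (fun r : Finset V => insert v (r.erase u)) hst
  have h3 : (T.filter fun s => v ∈ s ∧ u ∈ s).card ≤ Fintype.card V ^ 2 := by
    have hle : (Finset.powersetCard 2 (Finset.univ : Finset V)).card ≤ Fintype.card V ^ 2 := by
      rw [Finset.card_powersetCard, Finset.card_univ]
      exact Nat.choose_le_pow _ _
    refine le_trans (Finset.card_le_card_of_injOn (fun s => (s.erase v).erase u) ?_ ?_) hle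
    · intro s hs
      simp only [T, Finset.coe_filter, SimpleGraph.mem_cliqueFinset_iff, Set.mem_ofPred_eq] at hs
      refine Finset.mem_coe.2 (Finset.mem_powersetCard.2 ⟨Finset.subset_univ _, ?_⟩)
      rw [Finset.card_erase_of_mem (Finset.mem_erase.2 ⟨huv, hs.2.2⟩),
        Finset.card_erase_of_mem hs.2.1, hs.1.2]
    · intro s hs t ht hst
      simp only [Finset.coe_filter, Set.mem_ofPred_eq] at hs ht
      have e : ∀ r : Finset V, v ∈ r → u ∈ r → insert v (insert u ((r.erase v).erase u)) = r := by
        intro r hv hu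
        rw [Finset.insert_erase (Finset.mem_erase.2 ⟨huv, hu⟩), Finset.insert_erase hv]
      rw [← e s hs.2.1 hs.2.2, ← e t ht.2.1 ht.2.2]
      exact congrArg (fun r : Finset V => insert v (insert u r)) hst
  have h4 := Finset.card_filter_add_card_filter_not (s := T) (v ∈ ·)
  have h5 := Finset.card_filter_add_card_filter_not (s := T.filter (v ∈ ·)) (u ∈ ·)
  rw [Finset.filter_filter, Finset.filter_filter] at h5
  have h6 := Finset.card_filter_add_card_filter_not (s := G.cliqueFinset 4) (v ∈ ·)
  have h7 := Finset.card_le_card h1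
  have h8 : (cliquesAt G v).card = ((G.cliqueFinset 4).filter (v ∈ ·)).card := rfl
  omega

end Cliques

section BlowUp

variable {V : Type*}

/-- The blow-up of the pentagon whose parts are the fibres of `P`. -/
def blowUp (P : V → Fin 5) : SimpleGraph V where
  Adj u v := u ≠ v ∧ (P u = P v ∨ P u = P v + 1 ∨ P v = P u + 1)
  symm := ⟨fun _ _ h => ⟨h.1.symm, h.2.elim (fun h => Or.inl h.symm) fun h => Or.inr h.symm⟩⟩
  loopless := ⟨fun _ h => h.1 rfl⟩

theorem indepBound_blowUp (P : V → Fin 5) : IndepBound (blowUp P) 2 := by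
  intro s hs
  have hinj : Set.InjOn P (s : Set V) := by
    intro x hx y hy hxy
    by_contra hne
    exact hs x hx y hy hne ⟨hne, Or.inl hxy⟩
  rw [← Finset.card_image_of_injOn hinj]
  have key : ∀ I : Finset (Fin 5), (∀ i ∈ I, i + 1 ∉ I) → I.card ≤ 2 := by decide
  refine key _ fun i hi hi' => ?_
  obtain ⟨x, hx, rfl⟩ := Finset.mem_image.1 hi
  obtain ⟨y, hy, hxy⟩ := Finset.mem_image.1 hi'
  have hne : x ≠ y := by
    rintro rfl
    omega
  exact hs x hx y hy hne ⟨hne, Or.inr (Or.inr hxy)⟩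

variable [Fintype V] [DecidableEq V]

/-- The size of the part of index `j`. -/
def partSize (P : V → Fin 5) (j : Fin 5) : ℕ := (Finset.univ.filter fun v => P v = j).card

omit [DecidableEq V] in
theorem exists_partSize (b : Fin 5 → ℕ) (hb : ∑ j, b j = Fintype.card V) :
    ∃ P : V → Fin 5, ∀ j, partSize P j = b j := by
  have e : V ≃ (Σ j, Fin (b j)) := Fintype.equivOfCardEq (by simp [hb])
  refine ⟨fun v => (e v).1, fun j => ?_⟩
  rw [partSize, Finset.card_filter, Equiv.sum_comp e fun x => if x.1 = j then 1 else 0,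
    Fintype.sum_sigma, Finset.sum_eq_single j (fun i _ hi => by simp [hi]) (by simp)]
  simp

omit [Fintype V] in
theorem isClique_blowUp_iff (P : V → Fin 5) (s : Finset V) :
    (blowUp P).IsClique s ↔
      ∀ a ∈ s.image P, ∀ b ∈ s.image P, a = b ∨ a = b + 1 ∨ b = a + 1 := by
  simp only [Finset.forall_mem_image]
  refine ⟨fun h x hx y hy => ?_, fun h x hx y hy hxy => ⟨hxy, h hx hy⟩⟩
  by_cases hxy : x = y
  · exact Or.inl (hxy ▸ rfl)
  · exact (h hx hy hxy).2

theorem card_cliqueFinset_blowUp (P : V → Fin 5) [DecidableRel (blowUp P).Adj] :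
    ((blowUp P).cliqueFinset 4).card + ∑ i, (partSize P i).choose 4 =
      ∑ i, (partSize P i + partSize P (i + 1)).choose 4 := by
  have h1 : ∀ i, (partSize P i).choose 4 = ∑ s ∈ Finset.powersetCard 4 (Finset.univ : Finset V),
      if s.image P ⊆ {i} then 1 else 0 := by
    intro i
    rw [partSize, ← Finset.card_powersetCard, ← Finset.card_filter]
    congr 1
    ext s
    simp [Finset.mem_powersetCard, Finset.subset_iff, and_comm]
  have h2 : ∀ i, (partSize P i + partSize P (i + 1)).choose 4 =
      ∑ s ∈ Finset.powersetCard 4 (Finset.univ : Finset V),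
      if s.image P ⊆ {i, i + 1} then 1 else 0 := by
    intro i
    rw [partSize, partSize, ← Finset.card_union_of_disjoint, ← Finset.card_powersetCard,
      ← Finset.card_filter]
    · congr 1
      ext s
      simp [Finset.mem_powersetCard, Finset.subset_iff, and_comm]
    · rw [Finset.disjoint_left]
      intro v hv hv'
      have := (Finset.mem_filter.1 hv).2
      have := (Finset.mem_filter.1 hv').2
      omega
  have h3 : (blowUp P).cliqueFinset 4 = (Finset.powersetCard 4 (Finset.univ : Finset V)).filter
      fun s => ∀ a ∈ s.image P, ∀ b ∈ s.image P, a = b ∨ a = b + 1 ∨ b = a + 1 := by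
    ext s
    simp only [SimpleGraph.mem_cliqueFinset_iff, SimpleGraph.isNClique_iff, isClique_blowUp_iff,
      Finset.mem_filter, Finset.mem_powersetCard, Finset.subset_univ, true_and]
    exact and_comm
  simp only [h1, h2, h3]
  rw [Finset.sum_comm, Finset.sum_comm (t := Finset.powersetCard 4 _), Finset.card_filter,
    ← Finset.sum_add_distrib]
  refine Finset.sum_congr rfl fun s hs => ?_
  have hne : (s.image P).Nonempty := by
    rw [Finset.image_nonempty, ← Finset.card_pos, (Finset.mem_powersetCard.1 hs).2]
    norm_num
  have key : ∀ I : Finset (Fin 5), I.Nonempty →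
      (if ∀ a ∈ I, ∀ b ∈ I, a = b ∨ a = b + 1 ∨ b = a + 1 then 1 else 0) +
        ∑ i : Fin 5, (if I ⊆ {i} then 1 else 0) = ∑ i : Fin 5, if I ⊆ {i, i + 1} then 1 else 0 := by
    decide +kernel
  exact key _ hne

/-- The falling factorial `m (m - 1) (m - 2) (m - 3)`. -/
def falling (m : ℤ) : ℤ := m * (m - 1) * (m - 2) * (m - 3)

theorem falling_natCast (m : ℕ) : falling m = 24 * (m.choose 4 : ℕ) := by
  have h : m.descFactorial 4 = 24 * m.choose 4 := Nat.descFactorial_eq_factorial_mul_choose m 4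
  rw [← Nat.cast_ofNat (n := 24), ← Nat.cast_mul, ← h, falling]
  match m with
  | 0 => simp
  | 1 => simp [Nat.descFactorial]
  | 2 => simp [Nat.descFactorial]
  | m + 3 =>
    simp only [Nat.descFactorial]
    push_cast
    simp
    ring

/-- The number of ordered 4-cliques of the blow-up with parts of sizes `q`. -/
def blowCount (q : Fin 5 → ℤ) : ℤ := ∑ i, (falling (q i + q (i + 1)) - falling (q i))

theorem cliqueCount_blowUp (P : V → Fin 5) :
    24 * (cliqueCount (blowUp P) 4 : ℤ) = blowCount fun i => partSize P i := by
  classical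
  have h := congrArg (Nat.cast (R := ℤ)) (card_cliqueFinset_blowUp P)
  rw [cliqueCount_eq_card_cliqueFinset, blowCount, Finset.sum_sub_distrib]
  push_cast at h
  have h1 : ∀ i, falling ((partSize P i : ℤ) + partSize P (i + 1)) =
      24 * ((partSize P i + partSize P (i + 1)).choose 4 : ℕ) := fun i => by
    rw [← falling_natCast, Nat.cast_add]
  simp only [h1, falling_natCast, ← Finset.mul_sum]
  linarith

theorem minCliques_le {n : ℕ} {G : SimpleGraph (Fin n)} (hG : IndepBound G 2) :
    minCliques n 4 3 ≤ cliqueCount G 4 := Nat.sInf_le ⟨G, hG, rfl⟩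

theorem sum_bPart {n : ℕ} (hn : 5 ≤ n) : ∑ j, bPart n j = n := by
  rw [Fin.sum_univ_five, bPart]
  have h : n % 5 < 5 := Nat.mod_lt _ (by norm_num)
  have h2 := Nat.div_add_mod n 5
  split_ifs <;> simp only [Matrix.cons_val] <;> omega

theorem minCliques_le_blowCount {n : ℕ} (hn : 5 ≤ n) :
    24 * (minCliques n 4 3 : ℤ) ≤ blowCount fun j => bPart n j := by
  obtain ⟨P, hP⟩ := exists_partSize (V := Fin n) (bPart n) (by rw [sum_bPart hn, Fintype.card_fin])
  have h1 := minCliques_le (indepBound_blowUp P)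
  have h2 := cliqueCount_blowUp P
  simp only [hP] at h2
  rw [← h2]
  exact_mod_cast Nat.mul_le_mul_left 24 h1

end BlowUp

section Optimization

/-- The leading quadratic form in the deviations of the part sizes. -/
def quad (e : Fin 5 → ℤ) : ℤ := ∑ i, (4 * (e i + e (i + 1)) ^ 2 - e i ^ 2)

/-- The optimal deviations of the part sizes from `⌊n/5⌋`, by residue modulo 5. -/
def optDev : Fin 5 → Fin 5 → ℤ :=
  ![![0, 0, 0, 0, 0], ![0, 0, 1, -1, 1], ![0, 0, 1, 0, 1], ![1, 1, 0, 1, 0], ![1, 1, 0, 2, 0]]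

theorem sq_le_quad (e : Fin 5 → ℤ) (i : Fin 5) :
    1495 * (∑ j, e j) ^ 2 + 11 * (5 * e i - ∑ j, e j) ^ 2 ≤
      25 * (20 * quad e - ∑ j, e j ^ 2) := by
  have key : ∀ a b c d f : ℤ, 1495 * (a + b + c + d + f) ^ 2 +
      11 * (5 * a - (a + b + c + d + f)) ^ 2 ≤
      25 * (20 * (4 * (a + b) ^ 2 - a ^ 2 + (4 * (b + c) ^ 2 - b ^ 2) + (4 * (c + d) ^ 2 - c ^ 2)
        + (4 * (d + f) ^ 2 - d ^ 2) + (4 * (f + a) ^ 2 - f ^ 2))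
        - (a ^ 2 + b ^ 2 + c ^ 2 + d ^ 2 + f ^ 2)) := by
    intro a b c d f
    nlinarith [sq_nonneg (-1451 * a + 494 * b + 1969 * c + 494 * d - 1506 * f),
      sq_nonneg (-85609 * a - 128374 * b + 145317 * d + 68666 * f),
      sq_nonneg (-274291 * a + 2355077 * b - 2080786 * f), sq_nonneg (a - f)]
  have h := key (e i) (e (i + 1)) (e (i + 2)) (e (i + 3)) (e (i + 4))
  have hs : ∀ f : Fin 5 → ℤ, ∑ j, f j = f i + f (i + 1) + f (i + 2) + f (i + 3) + f (i + 4) := by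
    intro f
    rw [← Equiv.sum_comp (Equiv.addLeft i) f, Fin.sum_univ_five]
    simp
  rw [quad, hs e, hs fun j => e j ^ 2, hs fun j => 4 * (e j + e (j + 1)) ^ 2 - e j ^ 2]
  have e1 : i + 1 + 1 = i + 2 := by omega
  have e2 : i + 2 + 1 = i + 3 := by omega
  have e3 : i + 3 + 1 = i + 4 := by omega
  have e4 : i + 4 + 1 = i := by omega
  rw [e1, e2, e3, e4]
  exact h

theorem sum_optDev (r : Fin 5) : ∑ j, optDev r j = r := by
  revert r
  decide

theorem quad_optDev (r : Fin 5) : quad (optDev r) = ![0, 5, 14, 29, 50] r := by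
  revert r
  decide

theorem quad_small : ∀ r : Fin 5, ∀ a b c d : Fin 4,
    (fun a b c d f : ℤ => 1 + (a * a + b * b + c * c + d * d + f * f) ≤
      20 * (4 * ((a + b) * (a + b) + (b + c) * (b + c) + (c + d) * (c + d) + (d + f) * (d + f)
        + (f + a) * (f + a)) - (a * a + b * b + c * c + d * d + f * f) - ![0, 5, 14, 29, 50] r) ∨
      ∃ t : Fin 5, ∀ j, (![a, b, c, d, f] : Fin 5 → ℤ) (t + j) = optDev r j)
    (a - 1) (b - 1) (c - 1) (d - 1) (r - (a + b + c + d - 4)) := by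
  decide +kernel

/-- Up to rotation, the optimal deviations are unique, with a quadratic gap. -/
theorem quad_gap (r : Fin 5) (e : Fin 5 → ℤ) (he : ∑ j, e j = r) :
    (∃ t : Fin 5, ∀ j, e (t + j) = optDev r j) ∨
    1 + ∑ j, e j ^ 2 ≤ 20 * (quad e - quad (optDev r)) := by
  by_contra! hcon
  have hr : (r : ℤ) < 5 := by exact_mod_cast r.2
  have hr0 : (0 : ℤ) ≤ r := Int.natCast_nonneg _
  have hbd : ∀ i, -1 ≤ e i ∧ e i ≤ 2 := by
    intro i
    have h1 := sq_le_quad e i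
    have h2 : 25 * (1 + 20 * quad (optDev r)) < 1495 * (r : ℤ) ^ 2 + 2 * r + 1098 := by
      rw [quad_optDev]
      clear * -
      revert r
      decide
    rw [he] at h1
    constructor <;> nlinarith [hcon.2]
  have hf : ∀ i, ∃ a : Fin 4, e i = a - 1 := fun i =>
    ⟨⟨(e i + 1).toNat, by have := hbd i; omega⟩, by have := hbd i; simp; omega⟩
  obtain ⟨a, ha⟩ := hf 0
  obtain ⟨b, hb⟩ := hf 1
  obtain ⟨c, hc⟩ := hf 2
  obtain ⟨d, hd⟩ := hf 3
  have hval : e 4 = r - (a + b + c + d - 4) := by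
    rw [Fin.sum_univ_five] at he
    omega
  have h4 : e = ![e 0, e 1, e 2, e 3, e 4] := by
    ext j
    fin_cases j <;> rfl
  have h5 := quad_small r a b c d
  rw [← quad_optDev, ← ha, ← hb, ← hc, ← hd, ← hval, ← h4] at h5
  rcases h5 with h | ⟨t, ht⟩
  · have h6 : quad e = 4 * ((e 0 + e 1) * (e 0 + e 1) + (e 1 + e 2) * (e 1 + e 2)
        + (e 2 + e 3) * (e 2 + e 3) + (e 3 + e 4) * (e 3 + e 4) + (e 4 + e 0) * (e 4 + e 0))
        - (e 0 * e 0 + e 1 * e 1 + e 2 * e 2 + e 3 * e 3 + e 4 * e 4) := by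
      rw [quad, Fin.sum_univ_five, show (0 : Fin 5) + 1 = 1 from rfl,
        show (1 : Fin 5) + 1 = 2 from rfl, show (2 : Fin 5) + 1 = 3 from rfl,
        show (3 : Fin 5) + 1 = 4 from rfl, show (4 : Fin 5) + 1 = 0 from rfl]
      ring
    have h7 := hcon.2
    rw [h6, Fin.sum_univ_five] at h7
    linarith
  · obtain ⟨j, hj⟩ := hcon.1 t
    exact hj (ht j)

/-- The lower order part of `blowCount`. -/
def lowerOrder (k : ℤ) (e : Fin 5 → ℤ) : ℤ :=
  ∑ i, ((8 * k * (e i + e (i + 1)) ^ 3 - 36 * k * (e i + e (i + 1)) ^ 2 + (e i + e (i + 1)) ^ 4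
    - 6 * (e i + e (i + 1)) ^ 3 + 11 * (e i + e (i + 1)) ^ 2)
    - (4 * k * e i ^ 3 - 18 * k * e i ^ 2 + e i ^ 4 - 6 * e i ^ 3 + 11 * e i ^ 2))

theorem blowCount_add (k : ℤ) (e : Fin 5 → ℤ) :
    blowCount (fun i => k + e i) = 6 * k ^ 2 * quad e + lowerOrder k e
      + (60 * k ^ 3 - 126 * k ^ 2 + 66 * k - 6) * ∑ i, e i
      + 5 * (falling (2 * k) - falling k) := by
  have h1 : ∑ i, e (i + 1) = ∑ i, e i := Equiv.sum_comp (Equiv.addRight 1) e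
  have h2 : ∀ a b : ℤ, falling (k + a + (k + b)) - falling (k + a) =
      6 * k ^ 2 * (4 * (a + b) ^ 2 - a ^ 2)
      + ((8 * k * (a + b) ^ 3 - 36 * k * (a + b) ^ 2 + (a + b) ^ 4 - 6 * (a + b) ^ 3
        + 11 * (a + b) ^ 2) - (4 * k * a ^ 3 - 18 * k * a ^ 2 + a ^ 4 - 6 * a ^ 3 + 11 * a ^ 2))
      + ((32 * k ^ 3 - 72 * k ^ 2 + 44 * k - 6) * (a + b)
        - (4 * k ^ 3 - 18 * k ^ 2 + 22 * k - 6) * a)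
      + (falling (2 * k) - falling k) := by
    intro a b
    simp only [falling]
    ring
  simp only [blowCount, quad, lowerOrder, h2, Finset.sum_add_distrib, Finset.sum_sub_distrib,
    ← Finset.mul_sum, h1, Finset.sum_const, Finset.card_univ, Fintype.card_fin]
  simp only [nsmul_eq_mul]
  push_cast
  ring

/-- The lower order part of `blowCount` is small compared to the squared deviations. -/
theorem abs_lowerOrder_le {k : ℤ} (hk : 10 ^ 6 ≤ k) (e : Fin 5 → ℤ)
    (he : ∀ i, 1000 * |e i| ≤ k) : 10 * |lowerOrder k e| ≤ k ^ 2 * ∑ i, e i ^ 2 := by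
  have hone : ∀ x : ℤ, 500 * |x| ≤ k →
      |8 * k * x ^ 3 - 36 * k * x ^ 2 + x ^ 4 - 6 * x ^ 3 + 11 * x ^ 2| * 50 ≤ k ^ 2 * x ^ 2 ∧
      |4 * k * x ^ 3 - 18 * k * x ^ 2 + x ^ 4 - 6 * x ^ 3 + 11 * x ^ 2| * 50 ≤ k ^ 2 * x ^ 2 := by
    intro x hx
    have hx1 : 500 * x ≤ k := le_trans (by linarith [le_abs_self x]) hx
    have hx2 : -k ≤ 500 * x := by linarith [neg_abs_le x]
    have hxx : 250000 * x ^ 2 ≤ k ^ 2 := by nlinarith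
    have hx0 := sq_nonneg x
    have h1 : |8 * k * x - 36 * k + x ^ 2 - 6 * x + 11| * 50 ≤ k ^ 2 := by
      rcases abs_cases (8 * k * x - 36 * k + x ^ 2 - 6 * x + 11) with h | h <;> rw [h.1] <;>
        nlinarith
    have h2 : |4 * k * x - 18 * k + x ^ 2 - 6 * x + 11| * 50 ≤ k ^ 2 := by
      rcases abs_cases (4 * k * x - 18 * k + x ^ 2 - 6 * x + 11) with h | h <;> rw [h.1] <;>
        nlinarith
    rw [show 8 * k * x ^ 3 - 36 * k * x ^ 2 + x ^ 4 - 6 * x ^ 3 + 11 * x ^ 2 =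
      (8 * k * x - 36 * k + x ^ 2 - 6 * x + 11) * x ^ 2 by ring,
      show 4 * k * x ^ 3 - 18 * k * x ^ 2 + x ^ 4 - 6 * x ^ 3 + 11 * x ^ 2 =
      (4 * k * x - 18 * k + x ^ 2 - 6 * x + 11) * x ^ 2 by ring, abs_mul, abs_mul,
      abs_of_nonneg hx0]
    constructor <;> nlinarith
  have hterm : ∀ i, |(8 * k * (e i + e (i + 1)) ^ 3 - 36 * k * (e i + e (i + 1)) ^ 2
      + (e i + e (i + 1)) ^ 4 - 6 * (e i + e (i + 1)) ^ 3 + 11 * (e i + e (i + 1)) ^ 2)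
      - (4 * k * e i ^ 3 - 18 * k * e i ^ 2 + e i ^ 4 - 6 * e i ^ 3 + 11 * e i ^ 2)| * 50 ≤
      k ^ 2 * (3 * e i ^ 2 + 2 * e (i + 1) ^ 2) := by
    intro i
    have h1 := (hone (e i + e (i + 1))
      (by linarith [abs_add_le (e i) (e (i + 1)), he i, he (i + 1)])).1
    have h2 := (hone (e i) (by linarith [he i, abs_nonneg (e i)])).2
    have h3 : k ^ 2 * (e i + e (i + 1)) ^ 2 ≤ k ^ 2 * (2 * e i ^ 2 + 2 * e (i + 1) ^ 2) := by
      gcongr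
      nlinarith [sq_nonneg (e i - e (i + 1))]
    refine (mul_le_mul_of_nonneg_right (abs_sub _ _) (by norm_num)).trans ?_
    linarith
  have h1 : ∑ i, e (i + 1) ^ 2 = ∑ i, e i ^ 2 :=
    Equiv.sum_comp (Equiv.addRight 1) fun i => e i ^ 2
  have h2 := Finset.sum_le_sum fun i (_ : i ∈ Finset.univ) => hterm i
  rw [← Finset.sum_mul, ← Finset.mul_sum, Finset.sum_add_distrib, ← Finset.mul_sum,
    ← Finset.mul_sum, h1] at h2
  have h3 := Finset.abs_sum_le_sum_abs (fun i => (8 * k * (e i + e (i + 1)) ^ 3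
      - 36 * k * (e i + e (i + 1)) ^ 2
      + (e i + e (i + 1)) ^ 4 - 6 * (e i + e (i + 1)) ^ 3 + 11 * (e i + e (i + 1)) ^ 2)
      - (4 * k * e i ^ 3 - 18 * k * e i ^ 2 + e i ^ 4 - 6 * e i ^ 3 + 11 * e i ^ 2)) Finset.univ
  rw [lowerOrder]
  linarith

theorem abs_lowerOrder_optDev_le {k : ℤ} (hk : 10 ^ 6 ≤ k) (r : Fin 5) :
    |lowerOrder k (optDev r)| ≤ 2000 * k := by
  rw [abs_le]
  fin_cases r <;> simp [lowerOrder, optDev, Fin.sum_univ_five] <;> omega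

/-- Near the balanced blow-up, `blowCount` is minimised only at the optimal deviations. -/
theorem exists_eq_optDev {k : ℤ} (hk : 10 ^ 6 ≤ k) (r : Fin 5) (e : Fin 5 → ℤ)
    (hsum : ∑ i, e i = r) (he : ∀ i, 1000 * |e i| ≤ k)
    (hle : (blowCount fun i => k + e i) ≤ blowCount fun i => k + optDev r i) :
    ∃ t : Fin 5, ∀ j, e (t + j) = optDev r j := by
  refine (quad_gap r e hsum).resolve_right fun hgap => ?_
  rw [blowCount_add, blowCount_add, sum_optDev, hsum] at hle
  have h1 := abs_le.1 (abs_lowerOrder_optDev_le hk r)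
  have h2 := abs_lowerOrder_le hk e he
  have h3 := neg_abs_le (lowerOrder k e)
  have h4 : 0 ≤ ∑ i, e i ^ 2 := Finset.sum_nonneg fun i _ => sq_nonneg _
  have h5 : k ^ 2 * (1 + ∑ j, e j ^ 2) ≤ k ^ 2 * (20 * (quad e - quad (optDev r))) := by gcongr
  nlinarith

end Optimization

section Extremal

theorem exists_bPart_eq {n : ℕ} (hn : 5 ≤ n) :
    ∃ r : Fin 5, (r : ℕ) = n % 5 ∧ ∀ j, (bPart n j : ℤ) = (n / 5 : ℕ) + optDev r j := by
  have h1 : 1 ≤ n / 5 := by omega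
  have h2 : n % 5 = 0 ∨ n % 5 = 1 ∨ n % 5 = 2 ∨ n % 5 = 3 ∨ n % 5 = 4 := by omega
  rcases h2 with h | h | h | h | h
  · refine ⟨0, h.symm, fun j => ?_⟩
    fin_cases j <;> simp [bPart, h, optDev]
  · refine ⟨1, h.symm, fun j => ?_⟩
    fin_cases j <;> simp [bPart, h, optDev]
    omega
  · refine ⟨2, h.symm, fun j => ?_⟩
    fin_cases j <;> simp [bPart, h, optDev]
  · refine ⟨3, h.symm, fun j => ?_⟩
    fin_cases j <;> simp [bPart, h, optDev]
  · refine ⟨4, h.symm, fun j => ?_⟩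
    fin_cases j <;> simp [bPart, h, optDev]

theorem minCliques_le_real {n : ℕ} (hn : 10 ^ 7 ≤ n) :
    24 * (minCliques n 4 3 : ℝ) ≤ 3 / 25 * (n : ℝ) ^ 4 + (n : ℝ) ^ 3 := by
  obtain ⟨r, -, hr⟩ := exists_bPart_eq (n := n) (by omega)
  have h1 := minCliques_le_blowCount (n := n) (by omega)
  simp only [hr] at h1
  have hk : (10 : ℤ) ^ 6 ≤ (n / 5 : ℕ) := by omega
  have hkn : 5 * ((n / 5 : ℕ) : ℤ) ≤ n := by omega
  generalize ((n / 5 : ℕ) : ℤ) = k at *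
  have h2 : quad (optDev r) ≤ 50 := by
    rw [quad_optDev]
    clear * -
    revert r
    decide
  have h3 := (le_abs_self _).trans (abs_lowerOrder_optDev_le hk r)
  have hr4 : (r : ℤ) ≤ 4 := by omega
  rw [blowCount_add, sum_optDev] at h1
  have h4 : (60 * k ^ 3 - 126 * k ^ 2 + 66 * k - 6) * (r : ℤ) ≤
      (60 * k ^ 3 - 126 * k ^ 2 + 66 * k - 6) * 4 :=
    mul_le_mul_of_nonneg_left hr4 (by nlinarith [sq_nonneg k])
  have h5 : 6 * k ^ 2 * quad (optDev r) ≤ 6 * k ^ 2 * 50 :=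
    mul_le_mul_of_nonneg_left h2 (by positivity)
  have h6 : 5 * (falling (2 * k) - falling k) =
      75 * k ^ 4 - 210 * k ^ 3 + 165 * k ^ 2 - 30 * k := by
    rw [falling, falling]
    ring
  have h7 : 10 ^ 6 * k ^ 2 ≤ k ^ 3 := by nlinarith [sq_nonneg k]
  have h8 : 24 * (minCliques n 4 3 : ℤ) ≤ 75 * k ^ 4 + 125 * k ^ 3 := by nlinarith
  have h9 : 24 * (minCliques n 4 3 : ℝ) ≤ 75 * (k : ℝ) ^ 4 + 125 * (k : ℝ) ^ 3 := by
    exact_mod_cast h8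
  have hkn' : 5 * (k : ℝ) ≤ n := by exact_mod_cast hkn
  have hk0 : (0 : ℝ) ≤ k := by exact_mod_cast le_trans (by norm_num) hk
  have h10 : (5 * (k : ℝ)) ^ 4 ≤ (n : ℝ) ^ 4 := by gcongr
  have h11 : (5 * (k : ℝ)) ^ 3 ≤ (n : ℝ) ^ 3 := by gcongr
  linarith

variable {n : ℕ} {G : SimpleGraph (Fin n)}

theorem compl_triangle_free (hG : IndepBound G 2) (x y z : Fin n) (hxy : Gᶜ.Adj x y)
    (hxz : Gᶜ.Adj x z) : ¬ Gᶜ.Adj y z := by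
  intro hyz
  have h := hG {x, y, z} (by
    have h1 := hxy.2
    have h2 := hxz.2
    have h3 := hyz.2
    have h4 := fun h => h1 (G.adj_symm h)
    have h5 := fun h => h2 (G.adj_symm h)
    have h6 := fun h => h3 (G.adj_symm h)
    simp only [Finset.mem_insert, Finset.mem_singleton]
    rintro u (rfl | rfl | rfl) v (rfl | rfl | rfl) huv <;>
      first | assumption | exact absurd rfl huv)
  rw [Finset.card_eq_three.2 ⟨x, y, z, hxy.1, hxz.1, hyz.1, rfl⟩] at h
  omega

/-- In an extremal graph, every vertex lies in few 4-cliques, by symmetrisation. -/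
theorem mul_card_cliquesAt_le [DecidableRel G.Adj] (hG : IndepBound G 2)
    (hK : cliqueCount G 4 = minCliques n 4 3) (v : Fin n) :
    n * (cliquesAt G v).card ≤ 4 * minCliques n 4 3 + n ^ 3 := by
  classical
  have h : ∀ u ∈ Finset.univ, (cliquesAt G v).card ≤ (cliquesAt G u).card + n ^ 2 := by
    intro u _
    by_cases huv : u = v
    · rw [huv]
      exact Nat.le_add_right _ _
    · have h1 := card_cliqueFinset_twin_le G huv
      have h2 := minCliques_le (indepBound_twin hG u v)
      rw [← hK, cliqueCount_eq_card_cliqueFinset, cliqueCount_eq_card_cliqueFinset] at h2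
      rw [Fintype.card_fin] at h1
      omega
  have h1 := Finset.sum_le_sum h
  rw [Finset.sum_add_distrib, sum_card_cliquesAt, ← cliqueCount_eq_card_cliqueFinset, hK] at h1
  simp only [Finset.sum_const, Finset.card_univ, Fintype.card_fin, smul_eq_mul] at h1
  linarith [pow_succ' n 2]

/-- An extremal graph contains an almost balanced blow-up of the pentagon. -/
theorem exists_blowUp_le (hn : 10 ^ 24 ≤ n) (hG : IndepBound G 2)
    (hK : cliqueCount G 4 = minCliques n 4 3) :
    ∃ P : Fin n → Fin 5, blowUp P ≤ G ∧
      ∀ j, (1 / 5 - 18 / 10 ^ 6) * (n : ℝ) ≤ partSize P j := by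
  classical
  have hcard : Fintype.card (Fin n) = n := Fintype.card_fin n
  have hn' : (10 : ℝ) ^ 24 ≤ n := by exact_mod_cast hn
  have hmin := minCliques_le_real (n := n) (le_trans (by norm_num) hn)
  obtain ⟨Q, hQ, hsize⟩ := exists_parts_of_few (H := Gᶜ) (compl_triangle_free hG) (by
    have h1 := indepTuples_compl_le G
    rw [← cliqueCount_eq_card_cliqueFinset, hK, hcard] at h1
    have h2 : (indepTuples (fun x y => decide (Gᶜ.Adj x y)) : ℝ) ≤
        24 * (minCliques n 4 3 : ℝ) + 6 * (n : ℝ) ^ 3 := by exact_mod_cast h1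
    rw [hcard]
    have : (0 : ℝ) ≤ (n : ℝ) ^ 3 := by positivity
    linarith) (by
    intro v
    have h1 : ((indepTriples Gᶜ v).card : ℝ) ≤ 6 * (cliquesAt G v).card + 6 * (n : ℝ) ^ 2 := by
      have := card_indepTriples_le G v
      rw [hcard] at this
      exact_mod_cast this
    have h2 : (n : ℝ) * (cliquesAt G v).card ≤ 4 * minCliques n 4 3 + (n : ℝ) ^ 3 := by
      exact_mod_cast mul_card_cliquesAt_le hG hK v
    rw [hcard]
    have h3 : (n : ℝ) * (indepTriples Gᶜ v).card ≤ n * ((3 / 25 + 1 / 10 ^ 6) * (n : ℝ) ^ 3) := by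
      have h4 : (n : ℝ) * (indepTriples Gᶜ v).card ≤
          n * (6 * (cliquesAt G v).card + 6 * (n : ℝ) ^ 2) := by gcongr
      have h5 : (10 : ℝ) ^ 24 * (n : ℝ) ^ 3 ≤ n * (n : ℝ) ^ 3 := by gcongr
      have : (0 : ℝ) ≤ (n : ℝ) ^ 3 := by positivity
      linarith
    exact le_of_mul_le_mul_left h3 (by linarith)) (by rw [hcard]; exact hn')
  refine ⟨fun v => 2 * Q v, fun u v huv => ?_, fun j => ?_⟩
  · by_contra hnot
    have h1 := hQ u v ⟨huv.1, hnot⟩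
    have h2 := huv.2
    dsimp only at h2
    omega
  · have h := hsize (3 * j)
    rw [hcard] at h
    refine h.trans_eq ?_
    rw [partSize]
    congr 2
    ext x
    simp only [Finset.mem_filter, Finset.mem_univ, true_and]
    omega

/-- A minimal graph containing a blow-up of the pentagon with nontrivial parts equals it. -/
theorem eq_blowUp (hK : cliqueCount G 4 = minCliques n 4 3) {P : Fin n → Fin 5}
    (hP : blowUp P ≤ G) (hsize : ∀ j, 2 ≤ partSize P j) : G = blowUp P := by
  classical
  have hsub : (blowUp P).cliqueFinset 4 ⊆ G.cliqueFinset 4 := by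
    intro s
    simp only [SimpleGraph.mem_cliqueFinset_iff]
    exact fun h => h.mono hP
  have heq : (blowUp P).cliqueFinset 4 = G.cliqueFinset 4 := by
    refine Finset.eq_of_subset_of_card_le hsub ?_
    rw [← cliqueCount_eq_card_cliqueFinset, ← cliqueCount_eq_card_cliqueFinset, hK]
    exact minCliques_le (indepBound_blowUp P)
  have key : ∀ u w, G.Adj u w → P w ≠ P u + 2 := by
    intro u w huw hPw
    obtain ⟨x, hx, y, hy, hxy⟩ := Finset.one_lt_card.1 (hsize (P u + 1))
    have hx := (Finset.mem_filter.1 hx).2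
    have hy := (Finset.mem_filter.1 hy).2
    have hadj : ∀ a b, a ≠ b → (P a = P b ∨ P a = P b + 1 ∨ P b = P a + 1) → G.Adj a b :=
      fun a b hab h => hP ⟨hab, h⟩
    have hne : ∀ a b, P a ≠ P b → a ≠ b := fun a b h hab => h (hab ▸ rfl)
    have hux := hadj u x (hne _ _ (by omega)) (by omega)
    have huy := hadj u y (hne _ _ (by omega)) (by omega)
    have hwx := hadj w x (hne _ _ (by omega)) (by omega)
    have hwy := hadj w y (hne _ _ (by omega)) (by omega)
    have hxy := hadj x y hxy (by omega)
    have hmem : ({u, w, x, y} : Finset (Fin n)) ∈ G.cliqueFinset 4 := by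
      rw [SimpleGraph.mem_cliqueFinset_iff]
      refine (SimpleGraph.is3Clique_triple_iff.2 ⟨hwx, hwy, hxy⟩).insert ?_
      simpa using ⟨huw, hux, huy⟩
    rw [← heq, SimpleGraph.mem_cliqueFinset_iff] at hmem
    have h := (hmem.1 (by simp : u ∈ _) (by simp : w ∈ _) huw.ne).2
    omega
  refine le_antisymm (fun u w huw => ⟨huw.ne, ?_⟩) hP
  have h1 := key u w huw
  have h2 := key w u huw.symm
  omega

theorem exists_rotation_partSize {P : Fin n → Fin 5} (hn : 10 ^ 24 ≤ n)
    (hK : cliqueCount (blowUp P) 4 = minCliques n 4 3)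
    (hsize : ∀ j, (1 / 5 - 18 / 10 ^ 6) * (n : ℝ) ≤ partSize P j) :
    ∃ t : Fin 5, ∀ j, partSize P (t + j) = bPart n j := by
  obtain ⟨r, hrn, hr⟩ := exists_bPart_eq (n := n) (by omega)
  have hle := minCliques_le_blowCount (n := n) (by omega)
  have hblow := cliqueCount_blowUp P
  rw [hK] at hblow
  have hsum : ∑ j, partSize P j = n := by
    have := Finset.card_eq_sum_card_fiberwise (f := P) (s := Finset.univ) (t := Finset.univ)
      fun _ _ => by simp
    rw [Finset.card_univ, Fintype.card_fin] at this
    exact this.symm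
  have hk : (10 : ℤ) ^ 6 ≤ (n / 5 : ℕ) := by omega
  have hlow : ∀ j, (10 ^ 6 - 90) * (n : ℤ) ≤ 5 * 10 ^ 6 * partSize P j := by
    intro j
    have h : (10 ^ 6 - 90) * (n : ℝ) ≤ 5 * 10 ^ 6 * partSize P j := by linarith [hsize j]
    exact_mod_cast h
  rw [Fin.sum_univ_five] at hsum
  have h0 := hlow 0
  have h1 := hlow 1
  have h2 := hlow 2
  have h3 := hlow 3
  have h4 := hlow 4
  obtain ⟨t, ht⟩ := exists_eq_optDev hk r (fun j => partSize P j - (n / 5 : ℕ)) (by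
    rw [Fin.sum_univ_five]
    omega) (by
    intro i
    have hi : (partSize P i : ℤ) * (5 * 10 ^ 6) ≤ (10 ^ 6 + 360) * n := by
      fin_cases i <;> simp only [Fin.isValue, Fin.mk_zero, Fin.mk_one, Fin.reduceFinMk] <;> omega
    have hi' := hlow i
    rcases abs_cases ((partSize P i : ℤ) - (n / 5 : ℕ)) with h | h <;> rw [h.1] <;> omega) (by
    simp only [add_sub_cancel]
    rw [← hblow]
    simpa only [hr] using hle)
  refine ⟨t, fun j => ?_⟩
  have h5 := ht j
  have h6 := hr j
  omega

end Extremal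

end PentagonBlowUp

theorem erdos_43_extremal_structure :
    ∃ n₀ : ℕ, ∀ n : ℕ, n₀ ≤ n →
      ∀ G : SimpleGraph (Fin n), IndepBound G 2 → cliqueCount G 4 = minCliques n 4 3 →
        ∃ P : Fin n → Fin 5,
          (∀ j : Fin 5, ({v : Fin n | P v = j}).ncard = bPart n j) ∧
          (∀ u v : Fin n, u ≠ v →
            (G.Adj u v ↔ (P u = P v ∨ P u = P v + 1 ∨ P v = P u + 1))) := by
  refine ⟨10 ^ 24, fun n hn G hG hK => ?_⟩
  obtain ⟨P, hP, hsize⟩ := PentagonBlowUp.exists_blowUp_le hn hG hK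
  have hGP : G = PentagonBlowUp.blowUp P := by
    refine PentagonBlowUp.eq_blowUp hK hP fun j => ?_
    have h1 : (10 : ℝ) ^ 24 ≤ n := by exact_mod_cast hn
    have h2 : (2 : ℝ) ≤ PentagonBlowUp.partSize P j := by linarith [hsize j]
    exact_mod_cast h2
  subst hGP
  obtain ⟨t, ht⟩ := PentagonBlowUp.exists_rotation_partSize hn hK hsize
  refine ⟨fun v => P v - t, fun j => ?_, fun u v huv => ?_⟩
  · rw [← ht j, PentagonBlowUp.partSize, ← Set.ncard_coe_finset]
    congr 1
    ext v
    simp only [Finset.coe_filter, Finset.mem_univ, true_and, Set.mem_ofPred_eq]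
    omega
  · change (u ≠ v ∧ _) ↔ _
    rw [and_iff_right huv]
    dsimp only
    omega
end

section
/- There exists n₀ such that for all n ≥ n₀, f(n,3,4) = C(⌊n/3⌋,3) + C(⌊(n+1)/3⌋,3) + C(⌊(n+2)/3⌋,3); that is, the minimum number of triangles in a simple graph on n vertices with no independent set of 4 vertices equals the number of triangles in a disjoint union of three cliques whose sizes are as equal as possible. -/
/-- The integer `1` or `0` according to the truth value `b`. -/
def indicator (b : Bool) : ℤ := bif b then 1 else 0

/-- The bilinear form of the flags rooted at an independent triple. -/
def emptyGram (a b c a' b' c' : ℤ) : ℤ :=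
  a * (8 * a' + 8 * b' - 4 * c') + b * (8 * a' + 18 * b' - 10 * c')
    + c * (6 * c' - 4 * a' - 10 * b')

/-- The bilinear form of the flags rooted at a triple spanning one edge. -/
def edgeGram (a b c d e a' b' c' d' e' : ℤ) : ℤ :=
  a * (26 * a' - 14 * b' + 20 * c' - 2 * d' - 6 * e')
    + b * (58 * b' - 14 * a' - 8 * c' + 12 * d' - 40 * e')
    + c * (20 * a' - 8 * b' + 26 * c' + 7 * d' - 26 * e')
    + d * (12 * b' - 2 * a' + 7 * c' + 12 * d' - 30 * e')
    + e * (86 * e' - 6 * a' - 40 * b' - 26 * c' - 30 * d')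

/-- The bilinear form of the flags rooted at a triple spanning two edges. -/
def pathGram (a b c d s t a' b' c' d' s' t' : ℤ) : ℤ :=
  a * (26 * a' - 12 * b' + 22 * c' + 12 * d')
    + b * (14 * b' - 12 * a' - 16 * c' - 12 * d')
    + c * (22 * a' - 16 * b' + 28 * c' + 13 * d')
    + d * (12 * a' - 12 * b' + 13 * c' + 12 * d')
    + s * (36 * s' - 4 * t') + t * (20 * t' - 4 * s')

/-- The flag product at an independent root triple `x, y, z`, where `dx` tells whether `d` is
adjacent to `x`, and so on. -/
def emptyFlag (dx dy dz ex ey ez : Bool) : ℤ :=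
  let a (x y z : Bool) := 2 * indicator (!x && !y && !z) - indicator (x && y && z)
  let b (x y z : Bool) :=
    indicator (x && !y && !z) + indicator (!x && y && !z) + indicator (!x && !y && z)
  let c (x y z : Bool) :=
    indicator (!x && y && z) + indicator (x && !y && z) + indicator (x && y && !z)
  emptyGram (a dx dy dz) (b dx dy dz) (c dx dy dz) (a ex ey ez) (b ex ey ez) (c ex ey ez)

/-- The flag product at a root triple `x, y, z` whose only edge is `yz`. -/
def edgeFlag (dx dy dz ex ey ez : Bool) : ℤ :=
  let a (x y z : Bool) := indicator (!x && !y && !z)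
  let b (x y z : Bool) := indicator (x && !y && !z)
  let c (x y z : Bool) := indicator (!x && xor y z) - indicator (x && y && z)
  let d (x y z : Bool) := indicator (x && xor y z) - indicator (x && y && z)
  let e (x y z : Bool) := indicator (!x && y && z)
  edgeGram (a dx dy dz) (b dx dy dz) (c dx dy dz) (d dx dy dz) (e dx dy dz)
    (a ex ey ez) (b ex ey ez) (c ex ey ez) (d ex ey ez) (e ex ey ez)

/-- The flag product at a root triple `x, y, z` whose edges are `xy` and `xz`. -/
def pathFlag (dx dy dz ex ey ez : Bool) : ℤ :=
  let a (x y z : Bool) := indicator (!x && !y && !z)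
  let b (x y z : Bool) := indicator (!x && xor y z)
  let c (x y z : Bool) := indicator (x && !y && !z) - indicator (x && y && z)
  let d (x y z : Bool) :=
    indicator (x && xor y z) - 2 * indicator (!x && y && z) + 2 * indicator (x && y && z)
  let s (x y z : Bool) := indicator (!x && y && !z) - indicator (!x && !y && z)
  let t (x y z : Bool) := indicator (x && y && !z) - indicator (x && !y && z)
  pathGram (a dx dy dz) (b dx dy dz) (c dx dy dz) (d dx dy dz) (s dx dy dz) (t dx dy dz)
    (a ex ey ez) (b ex ey ez) (c ex ey ez) (d ex ey ez) (s ex ey ez) (t ex ey ez)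

/-- The flag product at a root triple `x, y, z` with prescribed edges. -/
def rootFlag (xy xz yz dx dy dz ex ey ez : Bool) : ℤ :=
  match xy, xz, yz with
  | false, false, false => emptyFlag dx dy dz ex ey ez
  | false, false, true => edgeFlag dx dy dz ex ey ez
  | false, true, false => edgeFlag dy dx dz ey ex ez
  | true, false, false => edgeFlag dz dx dy ez ex ey
  | true, true, false => pathFlag dx dy dz ex ey ez
  | true, false, true => pathFlag dy dx dz ey ex ez
  | false, true, true => pathFlag dz dx dy ez ex ey
  | true, true, true => 0

/-- Whether at most one of three truth values holds. -/
def atMostOne (x y z : Bool) : Bool := !(x && y) && !(x && z) && !(y && z)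

/-- The contribution of a root triple `x, y, z` and two further vertices `d, e`. -/
def localWeight (xy xz yz dx dy dz ex ey ez : Bool) : ℤ :=
  36 * indicator (!xy && !xz && !yz) - 4
    - 2 * indicator ((xy && xz && yz) && (atMostOne dx dy dz && atMostOne ex ey ez))
    - rootFlag xy xz yz dx dy dz ex ey ez

/-- The sum of `localWeight` over the ten root triples of a graph on five vertices. -/
def symmetrizedWeight (r01 r02 r03 r04 r12 r13 r14 r23 r24 r34 : Bool) : ℤ :=
  localWeight r01 r02 r12 r03 r13 r23 r04 r14 r24
    + localWeight r01 r03 r13 r02 r12 r23 r04 r14 r34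
    + localWeight r01 r04 r14 r02 r12 r24 r03 r13 r34
    + localWeight r02 r03 r23 r01 r12 r13 r04 r24 r34
    + localWeight r02 r04 r24 r01 r12 r14 r03 r23 r34
    + localWeight r03 r04 r34 r01 r13 r14 r02 r23 r24
    + localWeight r12 r13 r23 r01 r02 r03 r14 r24 r34
    + localWeight r12 r14 r24 r01 r02 r04 r13 r23 r34
    + localWeight r13 r14 r34 r01 r03 r04 r12 r23 r24
    + localWeight r23 r24 r34 r02 r03 r04 r12 r13 r14

theorem symmetrizedWeight_nonneg : ∀ r01 r02 r03 r04 r12 r13 r14 r23 r24 r34 : Bool,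
    (r01 && r02 && r03 && r12 && r13 && r23) = false →
    (r01 && r02 && r04 && r12 && r14 && r24) = false →
    (r01 && r03 && r04 && r13 && r14 && r34) = false →
    (r02 && r03 && r04 && r23 && r24 && r34) = false →
    (r12 && r13 && r14 && r23 && r24 && r34) = false →
    0 ≤ symmetrizedWeight r01 r02 r03 r04 r12 r13 r14 r23 r24 r34 := by
  decide +kernel

theorem emptyGram_self_nonneg (a b c : ℤ) : 0 ≤ emptyGram a b c a b c := by
  have : 5 * emptyGram a b c a b c = 10 * (2 * a + 2 * b - c) ^ 2 + 2 * (5 * b - 3 * c) ^ 2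
    + 2 * c ^ 2 := by unfold emptyGram; ring
  nlinarith [sq_nonneg (2 * a + 2 * b - c), sq_nonneg (5 * b - 3 * c), sq_nonneg c]

theorem edgeGram_self_nonneg (a b c d e : ℤ) : 0 ≤ edgeGram a b c d e a b c d e := by
  have : 69582084 * edgeGram a b c d e a b c d e =
      10704936 * (13 * a - 7 * b + 10 * c - d - 3 * e) ^ 2 +
      32637 * (328 * b + 18 * c + 71 * d - 281 * e) ^ 2 + 989 * (858 * c + 651 * d - 1559 * e) ^ 2
      + 246 * (989 * d - 1910 * e) ^ 2 + 9486334 * e ^ 2 := by unfold edgeGram; ring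
  have := sq_nonneg (13 * a - 7 * b + 10 * c - d - 3 * e)
  have := sq_nonneg (328 * b + 18 * c + 71 * d - 281 * e)
  have := sq_nonneg (858 * c + 651 * d - 1559 * e)
  have := sq_nonneg (989 * d - 1910 * e)
  have := sq_nonneg e
  linarith

theorem pathGram_self_nonneg (a b c d s t : ℤ) : 0 ≤ pathGram a b c d s t a b c d s t := by
  have : 210210 * pathGram a b c d s t a b c d s t =
      32340 * (13 * a - 6 * b + 11 * c + 6 * d) ^ 2 + 588 * (55 * b - 38 * c - 42 * d) ^ 2
      + 13 * (294 * c - 89 * d) ^ 2 + 218075 * d ^ 2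
      + 210210 * (4 * (3 * s) ^ 2 - 8 * s * t + 20 * t ^ 2) := by unfold pathGram; ring
  have := sq_nonneg (13 * a - 6 * b + 11 * c + 6 * d)
  have := sq_nonneg (55 * b - 38 * c - 42 * d)
  have := sq_nonneg (294 * c - 89 * d)
  have := sq_nonneg d
  have : 0 ≤ 4 * (3 * s) ^ 2 - 8 * s * t + 20 * t ^ 2 := by
    nlinarith [sq_nonneg (s - t), sq_nonneg s, sq_nonneg t]
  linarith

theorem sum_emptyGram_nonneg {V : Type*} [Fintype V] (a b c : V → ℤ) :
    0 ≤ ∑ d, ∑ e, emptyGram (a d) (b d) (c d) (a e) (b e) (c e) := by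
  refine (emptyGram_self_nonneg (∑ d, a d) (∑ d, b d) (∑ d, c d)).trans_eq ?_
  simp only [emptyGram, Finset.sum_add_distrib, Finset.sum_sub_distrib,
    ← Finset.mul_sum, ← Finset.sum_mul]

theorem sum_edgeGram_nonneg {V : Type*} [Fintype V] (a b c d e : V → ℤ) :
    0 ≤ ∑ v, ∑ w, edgeGram (a v) (b v) (c v) (d v) (e v) (a w) (b w) (c w) (d w) (e w) := by
  refine (edgeGram_self_nonneg (∑ v, a v) (∑ v, b v) (∑ v, c v) (∑ v, d v)
    (∑ v, e v)).trans_eq ?_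
  simp only [edgeGram, Finset.sum_add_distrib, Finset.sum_sub_distrib,
    ← Finset.mul_sum, ← Finset.sum_mul]

theorem sum_pathGram_nonneg {V : Type*} [Fintype V] (a b c d s t : V → ℤ) :
    0 ≤ ∑ v, ∑ w, pathGram (a v) (b v) (c v) (d v) (s v) (t v)
      (a w) (b w) (c w) (d w) (s w) (t w) := by
  refine (pathGram_self_nonneg (∑ v, a v) (∑ v, b v) (∑ v, c v) (∑ v, d v)
    (∑ v, s v) (∑ v, t v)).trans_eq ?_
  simp only [pathGram, Finset.sum_add_distrib, Finset.sum_sub_distrib,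
    ← Finset.mul_sum, ← Finset.sum_mul]

theorem sum_emptyFlag_nonneg {V : Type*} [Fintype V] (p q r : V → Bool) :
    0 ≤ ∑ d, ∑ e, emptyFlag (p d) (q d) (r d) (p e) (q e) (r e) := by
  simp only [emptyFlag]
  exact sum_emptyGram_nonneg _ _ _

theorem sum_edgeFlag_nonneg {V : Type*} [Fintype V] (p q r : V → Bool) :
    0 ≤ ∑ d, ∑ e, edgeFlag (p d) (q d) (r d) (p e) (q e) (r e) := by
  simp only [edgeFlag]
  exact sum_edgeGram_nonneg _ _ _ _ _

theorem sum_pathFlag_nonneg {V : Type*} [Fintype V] (p q r : V → Bool) :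
    0 ≤ ∑ d, ∑ e, pathFlag (p d) (q d) (r d) (p e) (q e) (r e) := by
  simp only [pathFlag]
  exact sum_pathGram_nonneg _ _ _ _ _ _

theorem sum_rootFlag_nonneg {V : Type*} [Fintype V] (xy xz yz : Bool) (p q r : V → Bool) :
    0 ≤ ∑ d, ∑ e, rootFlag xy xz yz (p d) (q d) (r d) (p e) (q e) (r e) := by
  cases xy <;> cases xz <;> cases yz <;>
    simp only [rootFlag, sum_emptyFlag_nonneg, sum_edgeFlag_nonneg, sum_pathFlag_nonneg,
      Finset.sum_const_zero, le_refl]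

theorem sum_fin_five_arrow {V : Type*} [Fintype V] (F : V → V → V → V → V → ℤ) :
    ∑ v : Fin 5 → V, F (v 0) (v 1) (v 2) (v 3) (v 4) =
      ∑ x, ∑ y, ∑ z, ∑ d, ∑ e, F x y z d e := by
  have key (m : ℕ) (f : (Fin (m + 1) → V) → ℤ) :
      ∑ v, f v = ∑ a, ∑ w : Fin m → V, f (Fin.cons a w) := by
    rw [← (Fin.consEquiv fun _ : Fin (m + 1) ↦ V).sum_comp, Fintype.sum_prod_type]
    rfl
  simp only [key]
  simp
  rfl

/-- Summing the flag inequality over all quintuples of vertices of a `K₄`-free graph with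
adjacency function `r`. -/
theorem sum_localWeight_nonneg {V : Type*} [Fintype V] (r : V → V → Bool)
    (hsymm : ∀ x y, r x y = r y x)
    (hfree : ∀ x y z w, (r x y && r x z && r x w && r y z && r y w && r z w) = false) :
    0 ≤ ∑ x, ∑ y, ∑ z, ∑ d, ∑ e, localWeight (r x y) (r x z) (r y z)
      (r x d) (r y d) (r z d) (r x e) (r y e) (r z e) := by
  let F (v : Fin 5 → V) := localWeight (r (v 0) (v 1)) (r (v 0) (v 2)) (r (v 1) (v 2))
      (r (v 0) (v 3)) (r (v 1) (v 3)) (r (v 2) (v 3)) (r (v 0) (v 4)) (r (v 1) (v 4))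
      (r (v 2) (v 4))
  have hperm (s : Fin 5 → Fin 5) (hs : s.Bijective) : ∑ v, F (v ∘ s) = ∑ v, F v :=
    ((Equiv.ofBijective s hs).symm.arrowCongr (Equiv.refl V)).sum_comp F
  have hpoint (v : Fin 5 → V) : 0 ≤ F (v ∘ ![0, 1, 2, 3, 4]) + F (v ∘ ![0, 1, 3, 2, 4])
      + F (v ∘ ![0, 1, 4, 2, 3]) + F (v ∘ ![0, 2, 3, 1, 4]) + F (v ∘ ![0, 2, 4, 1, 3])
      + F (v ∘ ![0, 3, 4, 1, 2]) + F (v ∘ ![1, 2, 3, 0, 4]) + F (v ∘ ![1, 2, 4, 0, 3])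
      + F (v ∘ ![1, 3, 4, 0, 2]) + F (v ∘ ![2, 3, 4, 0, 1]) := by
    have h := symmetrizedWeight_nonneg (r (v 0) (v 1)) (r (v 0) (v 2)) (r (v 0) (v 3))
      (r (v 0) (v 4)) (r (v 1) (v 2)) (r (v 1) (v 3)) (r (v 1) (v 4)) (r (v 2) (v 3))
      (r (v 2) (v 4)) (r (v 3) (v 4)) (hfree _ _ _ _) (hfree _ _ _ _) (hfree _ _ _ _)
      (hfree _ _ _ _) (hfree _ _ _ _)
    simp only [symmetrizedWeight] at h
    simp only [F, Function.comp, Matrix.cons_val]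
    rw [hsymm (v 1) (v 0), hsymm (v 2) (v 0), hsymm (v 3) (v 0), hsymm (v 4) (v 0),
      hsymm (v 2) (v 1), hsymm (v 3) (v 1), hsymm (v 4) (v 1), hsymm (v 3) (v 2),
      hsymm (v 4) (v 2), hsymm (v 4) (v 3)]
    exact h
  have hsum := Finset.sum_nonneg fun v (_ : v ∈ Finset.univ) ↦ hpoint v
  simp only [Finset.sum_add_distrib] at hsum
  rw [hperm _ (by decide), hperm _ (by decide), hperm _ (by decide), hperm _ (by decide),
    hperm _ (by decide), hperm _ (by decide), hperm _ (by decide), hperm _ (by decide),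
    hperm _ (by decide), hperm _ (by decide)] at hsum
  have : ∑ v, F v = _ := sum_fin_five_arrow fun x y z d e ↦ localWeight (r x y) (r x z) (r y z)
      (r x d) (r y d) (r z d) (r x e) (r y e) (r z e)
  linarith

theorem indicator_and (a b : Bool) : indicator (a && b) = indicator a * indicator b := by
  cases a <;> cases b <;> rfl

theorem sum_sum_localWeight_le {V : Type*} [Fintype V] (xy xz yz : Bool) (p q s : V → Bool) :
    ∑ d, ∑ e, localWeight xy xz yz (p d) (q d) (s d) (p e) (q e) (s e) ≤
      (Fintype.card V : ℤ) ^ 2 * (36 * indicator (!xy && !xz && !yz) - 4)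
        - 2 * (indicator (xy && xz && yz) * (∑ d, indicator (atMostOne (p d) (q d) (s d))) ^ 2) := by
  have h := sum_rootFlag_nonneg xy xz yz p q s
  simp only [localWeight, Finset.sum_sub_distrib, indicator_and _ (atMostOne _ _ _ && _)]
  simp only [indicator_and (atMostOne _ _ _), ← Finset.mul_sum, ← Finset.sum_mul,
    Finset.sum_const, Finset.card_univ, nsmul_eq_mul, ← sq] at h ⊢
  linarith

/-- In a `K₄`-free graph with few independent triples, most vertices are adjacent to two vertices
of an average triangle. -/
theorem sum_triangle_sq_le {V : Type*} [Fintype V] (r : V → V → Bool)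
    (hsymm : ∀ x y, r x y = r y x)
    (hfree : ∀ x y z w, (r x y && r x z && r x w && r y z && r y w && r z w) = false) :
    ∑ x, ∑ y, ∑ z, indicator (r x y && r x z && r y z) *
        (∑ d, indicator (atMostOne (r x d) (r y d) (r z d))) ^ 2 ≤
      18 * (Fintype.card V : ℤ) ^ 2 * ∑ x, ∑ y, ∑ z, indicator (!r x y && !r x z && !r y z)
        - 2 * (Fintype.card V : ℤ) ^ 5 := by
  have h := (sum_localWeight_nonneg r hsymm hfree).trans
    (Finset.sum_le_sum fun x _ ↦ Finset.sum_le_sum fun y _ ↦ Finset.sum_le_sum fun z _ ↦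
      sum_sum_localWeight_le (r x y) (r x z) (r y z) (r x) (r y) (r z))
  simp only [Finset.sum_sub_distrib, ← Finset.mul_sum,
    Finset.sum_const, Finset.card_univ, nsmul_eq_mul] at h
  linarith

theorem card_pow_three_le_sum_indicator {V : Type*} [Fintype V] (r : V → V → Bool)
    (hsymm : ∀ x y, r x y = r y x) :
    (Fintype.card V : ℤ) ^ 3 ≤
      4 * (∑ x, ∑ y, ∑ z, indicator (!r x y && !r x z && !r y z)
        + ∑ x, ∑ y, ∑ z, indicator (r x y && r x z && r y z)) := by
  let s (x y : V) : ℤ := 1 - 2 * indicator (r x y)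
  have hs (x y : V) : s x y = s y x := by simp only [s, hsymm x y]
  have hpoint (x y z : V) : 4 * (indicator (!r x y && !r x z && !r y z)
      + indicator (r x y && r x z && r y z)) =
      1 + s x y * s x z + s x y * s y z + s x z * s y z := by
    simp only [s]
    cases r x y <;> cases r x z <;> cases r y z <;> rfl
  have h1 : ∑ x, ∑ y, ∑ z, s x y * s x z = ∑ x, (∑ y, s x y) ^ 2 :=
    Finset.sum_congr rfl fun x _ ↦ by rw [sq, Finset.sum_mul_sum]
  have h2 : ∑ x, ∑ y, ∑ z, s x y * s y z = ∑ x, (∑ y, s x y) ^ 2 := by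
    rw [Finset.sum_comm, ← h1]
    simp only [hs]
  have h3 : ∑ x, ∑ y, ∑ z, s x z * s y z = ∑ x, (∑ y, s x y) ^ 2 := by
    rw [← h2]
    refine Finset.sum_congr rfl fun x _ ↦ ?_
    rw [Finset.sum_comm]
    exact Finset.sum_congr rfl fun z _ ↦ Finset.sum_congr rfl fun y _ ↦ by rw [hs y z]
  have h4 : 0 ≤ ∑ x, (∑ y, s x y) ^ 2 := Finset.sum_nonneg fun x _ ↦ sq_nonneg _
  simp only [← Finset.sum_add_distrib, Finset.mul_sum, hpoint]
  simp only [Finset.sum_add_distrib, h1, h2, h3, Finset.sum_const, Finset.card_univ,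
    nsmul_eq_mul]
  linarith

theorem cliqueCount_eq_card_cliqueFinset {V : Type*} [Fintype V] [DecidableEq V]
    (G : SimpleGraph V) [DecidableRel G.Adj] (k : ℕ) :
    cliqueCount G k = (G.cliqueFinset k).card := by
  rw [cliqueCount, ← Nat.card_eq_finsetCard]
  refine Nat.card_congr (Equiv.subtypeEquivRight fun s ↦ ?_)
  rw [SimpleGraph.mem_cliqueFinset_iff, SimpleGraph.isNClique_iff, and_comm]

theorem card_triples_le_six {V : Type*} [Fintype V] [DecidableEq V] (s : Finset V)
    (hs : s.card = 3) :
    (Finset.univ.filter fun p : V × V × V ↦ ({p.1, p.2.1, p.2.2} : Finset V) = s).card ≤ 6 := by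
  obtain ⟨a, b, c, hab, hac, hbc, rfl⟩ := Finset.card_eq_three.1 hs
  refine (Finset.card_le_card (t := {(a, b, c), (a, c, b), (b, a, c), (b, c, a), (c, a, b),
    (c, b, a)}) ?_).trans Finset.card_le_six
  rintro ⟨x, y, z⟩ h
  have h' : ({x, y, z} : Finset V) = {a, b, c} := (Finset.mem_filter.1 h).2
  have hx : x ∈ ({a, b, c} : Finset V) := by simp [← h']
  have hy : y ∈ ({a, b, c} : Finset V) := by simp [← h']
  have hz : z ∈ ({a, b, c} : Finset V) := by simp [← h']
  have ha : a ∈ ({x, y, z} : Finset V) := by simp [h']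
  have hb : b ∈ ({x, y, z} : Finset V) := by simp [h']
  have hc : c ∈ ({x, y, z} : Finset V) := by simp [h']
  simp only [Finset.mem_insert, Finset.mem_singleton, Prod.mk.injEq] at *
  grind

/-- The number of triples spanning no edge of the complement of `G`. -/
theorem sum_indicator_le_cliqueCount {V : Type*} [Fintype V] (G : SimpleGraph V)
    (r : V → V → Bool) (hr : ∀ x y, r x y = true ↔ Gᶜ.Adj x y) :
    ∑ x, ∑ y, ∑ z, indicator (!r x y && !r x z && !r y z) ≤
      6 * (cliqueCount G 3 : ℤ) + 3 * (Fintype.card V : ℤ) ^ 2 := by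
  classical
  have hcount : ((Finset.univ.filter fun p : V × V × V ↦
      G.Adj p.1 p.2.1 ∧ G.Adj p.1 p.2.2 ∧ G.Adj p.2.1 p.2.2).card : ℤ) ≤
      6 * (cliqueCount G 3 : ℤ) := by
    rw [cliqueCount_eq_card_cliqueFinset]
    norm_cast
    refine Finset.card_le_mul_card_image_of_maps_to
      (f := fun p : V × V × V ↦ ({p.1, p.2.1, p.2.2} : Finset V)) ?_ 6 ?_
    · rintro ⟨x, y, z⟩ h
      rw [SimpleGraph.mem_cliqueFinset_iff, SimpleGraph.is3Clique_triple_iff]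
      exact (Finset.mem_filter.1 h).2
    · intro s hs
      refine (Finset.card_le_card fun p hp ↦ ?_).trans
        (card_triples_le_six s ((SimpleGraph.mem_cliqueFinset_iff.1 hs).card_eq))
      simp only [Finset.mem_filter, Finset.mem_univ, true_and] at hp ⊢
      exact hp.2
  have hpoint (x y z : V) : indicator (!r x y && !r x z && !r y z) ≤
      (if G.Adj x y ∧ G.Adj x z ∧ G.Adj y z then 1 else 0) + (if x = y then 1 else 0)
        + (if x = z then 1 else 0) + (if y = z then 1 else 0) := by
    have h1 := hr x y
    have h2 := hr x z
    have h3 := hr y z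
    simp only [SimpleGraph.compl_adj] at h1 h2 h3
    cases h1' : r x y <;> cases h2' : r x z <;> cases h3' : r y z <;> simp [indicator] <;> grind
  refine (Finset.sum_le_sum fun x _ ↦ Finset.sum_le_sum fun y _ ↦ Finset.sum_le_sum fun z _ ↦
    hpoint x y z).trans ?_
  simp only [Finset.sum_add_distrib]
  have htri : ∑ x, ∑ y, ∑ z, (if G.Adj x y ∧ G.Adj x z ∧ G.Adj y z then (1 : ℤ) else 0) =
      (Finset.univ.filter fun p : V × V × V ↦
        G.Adj p.1 p.2.1 ∧ G.Adj p.1 p.2.2 ∧ G.Adj p.2.1 p.2.2).card := by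
    rw [Finset.card_filter, Fintype.sum_prod_type]
    simp only [Fintype.sum_prod_type]
    push_cast
    rfl
  rw [htri]
  simp
  linarith

theorem exists_triangle_of_cliqueCount_le {V : Type*} [Fintype V] (G : SimpleGraph V)
    (r : V → V → Bool) (hr : ∀ x y, r x y = true ↔ Gᶜ.Adj x y)
    (hfree : ∀ x y z w, (r x y && r x z && r x w && r y z && r y w && r z w) = false)
    (K : ℕ) (hK : 540 * K ^ 2 < Fintype.card V) (hn : 100 ≤ Fintype.card V)
    (ht : 54 * cliqueCount G 3 ≤ Fintype.card V ^ 3) :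
    ∃ x y z, r x y = true ∧ r x z = true ∧ r y z = true ∧
      K * (Finset.univ.filter fun w ↦ atMostOne (r x w) (r y w) (r z w) = true).card <
        Fintype.card V := by
  by_contra! hcon
  have hsymm (x y : V) : r x y = r y x := by
    rw [Bool.eq_iff_iff, hr, hr, SimpleGraph.adj_comm]
  have h1 := sum_triangle_sq_le r hsymm hfree
  have h2 := card_pow_three_le_sum_indicator r hsymm
  have h3 := sum_indicator_le_cliqueCount G r hr
  set n := Fintype.card V
  have h4 : (n : ℤ) ^ 2 * ∑ x, ∑ y, ∑ z, indicator (r x y && r x z && r y z) ≤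
      (K : ℤ) ^ 2 * ∑ x, ∑ y, ∑ z, indicator (r x y && r x z && r y z) *
        (∑ d, indicator (atMostOne (r x d) (r y d) (r z d))) ^ 2 := by
    simp only [Finset.mul_sum]
    refine Finset.sum_le_sum fun x _ ↦ Finset.sum_le_sum fun y _ ↦ Finset.sum_le_sum fun z _ ↦ ?_
    by_cases h : r x y = true ∧ r x z = true ∧ r y z = true
    · have hbad := hcon x y z h.1 h.2.1 h.2.2
      have hsum : ∑ d, indicator (atMostOne (r x d) (r y d) (r z d)) =
          (Finset.univ.filter fun w ↦ atMostOne (r x w) (r y w) (r z w) = true).card := by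
        rw [Finset.card_filter]
        push_cast
        exact Finset.sum_congr rfl fun d _ ↦ by
          cases atMostOne (r x d) (r y d) (r z d) <;> rfl
      rw [hsum, h.1, h.2.1, h.2.2]
      simp only [indicator, Bool.and_self, cond_true, mul_one, one_mul]
      rw [← mul_pow]
      gcongr
      exact_mod_cast hbad
    · have : (r x y && r x z && r y z) = false := by grind
      simp [this, indicator]
  set I := ∑ x, ∑ y, ∑ z, indicator (!r x y && !r x z && !r y z)
  set T := ∑ x, ∑ y, ∑ z, indicator (r x y && r x z && r y z)
  set J := ∑ x, ∑ y, ∑ z, indicator (r x y && r x z && r y z) *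
        (∑ d, indicator (atMostOne (r x d) (r y d) (r z d))) ^ 2
  have hn' : (100 : ℤ) ≤ n := by exact_mod_cast hn
  have hK' : (540 : ℤ) * K ^ 2 < n := by exact_mod_cast hK
  have ht' : 54 * (cliqueCount G 3 : ℤ) ≤ n ^ 3 := by exact_mod_cast ht
  have hI : 9 * I ≤ n ^ 3 + 27 * n ^ 2 := by linarith
  have hJ : J ≤ 54 * n ^ 4 := by nlinarith [mul_le_mul_of_nonneg_left hI (sq_nonneg (n : ℤ))]
  have hT : (n : ℤ) ^ 3 ≤ 10 * T := by
    nlinarith [mul_le_mul_of_nonneg_left hn' (sq_nonneg (n : ℤ))]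
  have h5 : (n : ℤ) ^ 2 * n ^ 3 ≤ 10 * (K ^ 2 * (54 * n ^ 4)) := by
    have := mul_le_mul_of_nonneg_left hT (sq_nonneg (n : ℤ))
    have := mul_le_mul_of_nonneg_left hJ (sq_nonneg (K : ℤ))
    linarith
  have h6 : (540 : ℤ) * K ^ 2 * n ^ 4 < n * n ^ 4 := by gcongr
  linarith

theorem two_mul_choose_two (m : ℕ) : 2 * (m.choose 2 : ℤ) = m * (m - 1) := by
  induction m with
  | zero => simp
  | succ m ih =>
    rw [Nat.choose_succ_succ' m 1, Nat.choose_one_right]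
    push_cast
    linarith

theorem card_insert_triangles_le {V : Type*} [Fintype V] [DecidableEq V] (G : SimpleGraph V)
    [DecidableRel G.Adj] (v : V) (S T : Finset V) (hS : G.IsClique S) (hT : G.IsClique T)
    (hST : Disjoint S T) (hvS : ∀ w ∈ S, G.Adj v w) (hvT : ∀ w ∈ T, G.Adj v w) :
    (S.card : ℤ) * (S.card - 1) + T.card * (T.card - 1) ≤
      2 * ((G.cliqueFinset 3).filter (v ∈ ·)).card := by
  have hdisj : Disjoint (S.powersetCard 2) (T.powersetCard 2) := by
    rw [Finset.disjoint_left]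
    intro p hp hp'
    rw [Finset.mem_powersetCard] at hp hp'
    obtain ⟨w, hw⟩ := Finset.card_pos.1 (hp.2.symm ▸ two_pos : 0 < p.card)
    exact Finset.disjoint_left.1 hST (hp.1 hw) (hp'.1 hw)
  have hmem {R : Finset V} (hR : G.IsClique R) (hvR : ∀ w ∈ R, G.Adj v w) {p : Finset V}
      (hp : p ∈ R.powersetCard 2) : v ∉ p ∧ insert v p ∈ G.cliqueFinset 3 := by
    rw [Finset.mem_powersetCard] at hp
    have hvp : v ∉ p := fun h ↦ G.loopless.irrefl v (hvR v (hp.1 h))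
    refine ⟨hvp, ?_⟩
    rw [SimpleGraph.mem_cliqueFinset_iff, SimpleGraph.isNClique_iff,
      Finset.card_insert_of_notMem hvp, hp.2, Finset.coe_insert]
    exact ⟨(hR.subset (Finset.coe_subset.2 hp.1)).insert fun w hw _ ↦ hvR w (hp.1 hw), rfl⟩
  have hall {p : Finset V} (hp : p ∈ S.powersetCard 2 ∪ T.powersetCard 2) :
      v ∉ p ∧ insert v p ∈ G.cliqueFinset 3 :=
    (Finset.mem_union.1 hp).elim (hmem hS hvS) (hmem hT hvT)
  have hcard : (S.powersetCard 2 ∪ T.powersetCard 2).card ≤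
      ((G.cliqueFinset 3).filter (v ∈ ·)).card := by
    refine Finset.card_le_card_of_injOn (insert v) (fun p hp ↦ ?_) fun p hp q hq h ↦ ?_
    · exact Finset.mem_filter.2 ⟨(hall hp).2, Finset.mem_insert_self v p⟩
    · rw [← Finset.erase_insert (hall hp).1, ← Finset.erase_insert (hall hq).1, h]
  rw [Finset.card_union_of_disjoint hdisj, Finset.card_powersetCard,
    Finset.card_powersetCard] at hcard
  have : (S.card.choose 2 : ℤ) + T.card.choose 2 ≤
      ((G.cliqueFinset 3).filter (v ∈ ·)).card := by exact_mod_cast hcard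
  linarith [two_mul_choose_two S.card, two_mul_choose_two T.card]

theorem exists_adj_triple {V : Type*} [DecidableEq V] (H : SimpleGraph V) [DecidableRel H.Adj]
    (S : Finset V) (u v w : V)
    (h : (S.filter (¬H.Adj u ·)).card + (S.filter (¬H.Adj v ·)).card
      + (S.filter (¬H.Adj w ·)).card < S.card) :
    ∃ z ∈ S, H.Adj u z ∧ H.Adj v z ∧ H.Adj w z := by
  by_contra! hcon
  refine h.not_ge ?_
  refine (Finset.card_le_card (t := S.filter (¬H.Adj u ·) ∪ S.filter (¬H.Adj v ·)
    ∪ S.filter (¬H.Adj w ·)) fun z hz ↦ ?_).trans ((Finset.card_union_le _ _).trans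
      (Nat.add_le_add_right (Finset.card_union_le _ _) _))
  have := hcon z hz
  simp only [Finset.mem_union, Finset.mem_filter]
  tauto

theorem exists_partition_of_triangle {V : Type*} [Fintype V] (G : SimpleGraph V)
    (hfree : ∀ x y z w, Gᶜ.Adj x y → Gᶜ.Adj x z → Gᶜ.Adj x w → Gᶜ.Adj y z → Gᶜ.Adj y w →
      ¬Gᶜ.Adj z w) (τ : Fin 3 → V) (hτ : ∀ i j, i ≠ j → Gᶜ.Adj (τ i) (τ j)) :
    ∃ A : Fin 3 → Finset V, (∀ i, G.IsClique (A i)) ∧ (∀ i j, i ≠ j → Disjoint (A i) (A j)) ∧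
      ∀ w, (∀ i, w ∉ A i) → ∃ i, ∀ j, j ≠ i → ¬Gᶜ.Adj (τ j) w := by
  classical
  refine ⟨fun i ↦ Finset.univ.filter fun w ↦ ∀ j, Gᶜ.Adj (τ j) w ↔ j ≠ i, fun i ↦ ?_,
    fun i j hij ↦ ?_, fun w hw ↦ ?_⟩
  · intro u hu w hw huw
    simp only [Finset.coe_filter, Finset.mem_univ, true_and, Set.mem_ofPred_eq] at hu hw
    by_contra h
    have hadj : Gᶜ.Adj u w := by simp [huw, h]
    obtain ⟨j, k, hj, hk, hjk⟩ : ∃ j k : Fin 3, j ≠ i ∧ k ≠ i ∧ j ≠ k :=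
      (by decide : ∀ i : Fin 3, ∃ j k : Fin 3, j ≠ i ∧ k ≠ i ∧ j ≠ k) i
    exact hfree _ _ _ _ (hτ j k hjk) ((hu j).2 hj) ((hw j).2 hj) ((hu k).2 hk) ((hw k).2 hk) hadj
  · rw [Finset.disjoint_left]
    intro w hw hw'
    simp only [Finset.mem_filter, Finset.mem_univ, true_and] at hw hw'
    exact (hw' j).1 ((hw j).2 hij.symm) rfl
  · simp only [Finset.mem_filter, Finset.mem_univ, true_and] at hw
    obtain ⟨i, hi⟩ : ∃ i, ¬Gᶜ.Adj (τ i) w := by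
      by_contra! h
      exact hfree (τ 0) (τ 1) (τ 2) w (hτ _ _ (by decide)) (hτ _ _ (by decide)) (h 0)
        (hτ _ _ (by decide)) (h 1) (h 2)
    obtain ⟨j, hj⟩ := not_forall.1 (hw i)
    have hji : j ≠ i := by
      rintro rfl
      exact hj (iff_of_false hi fun h ↦ h rfl)
    have hjw : ¬Gᶜ.Adj (τ j) w := fun h ↦ hj (iff_of_true h hji)
    obtain ⟨k, hk⟩ := (by decide : ∀ i j : Fin 3, j ≠ i → ∃ k, ∀ l, l ≠ k → l = i ∨ l = j) i j hji
    exact ⟨k, fun l hl ↦ (hk l hl).elim (fun h ↦ h ▸ hi) fun h ↦ h ▸ hjw⟩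

theorem exists_three_cliques {V : Type*} [Fintype V] [DecidableEq V] (G : SimpleGraph V)
    [DecidableRel G.Adj]
    (hfree : ∀ x y z w, Gᶜ.Adj x y → Gᶜ.Adj x z → Gᶜ.Adj x w → Gᶜ.Adj y z → Gᶜ.Adj y w →
      ¬Gᶜ.Adj z w) (A : Fin 3 → Finset V) (hA : ∀ i, G.IsClique (A i))
    (hdisj : ∀ i j, i ≠ j → Disjoint (A i) (A j)) (hn : 10 ^ 7 ≤ Fintype.card V)
    (hsum : 10 ^ 5 * Fintype.card V ≤ 10 ^ 5 * ∑ i, (A i).card + Fintype.card V)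
    (hlight : ∀ v, 18 * ((G.cliqueFinset 3).filter (v ∈ ·)).card ≤ Fintype.card V ^ 2) :
    ∃ c : V → Fin 3, ∀ u v, u ≠ v → c u = c v → G.Adj u v := by
  set n := Fintype.card V
  have hn' : (10 : ℤ) ^ 7 ≤ n := by exact_mod_cast hn
  let M (v : V) (i : Fin 3) : ℕ := ((A i).filter (¬Gᶜ.Adj v ·)).card
  have hM (v : V) (i : Fin 3) : (M v i : ℤ) ≤ ((A i).filter (G.Adj v ·)).card + 1 := by
    have : M v i ≤ (insert v ((A i).filter (G.Adj v ·))).card := by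
      refine Finset.card_le_card fun w hw ↦ ?_
      simp only [Finset.mem_filter, SimpleGraph.compl_adj, Finset.mem_insert] at hw ⊢
      tauto
    exact_mod_cast this.trans (Finset.card_insert_le _ _)
  have hMadd (v : V) (i : Fin 3) : ((A i).filter (Gᶜ.Adj v ·)).card + M v i = (A i).card :=
    Finset.card_filter_add_card_filter_not _
  have htwo (v : V) (S T : Finset V) (hS : G.IsClique S) (hT : G.IsClique T)
      (hST : Disjoint S T) (hvS : ∀ w ∈ S, G.Adj v w) (hvT : ∀ w ∈ T, G.Adj v w) :
      9 * ((S.card : ℤ) * (S.card - 1) + T.card * (T.card - 1)) ≤ n ^ 2 := by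
    have h1 := card_insert_triangles_le G v S T hS hT hST hvS hvT
    have h2 : (18 : ℤ) * ((G.cliqueFinset 3).filter (v ∈ ·)).card ≤ n ^ 2 := by
      exact_mod_cast hlight v
    linarith
  have hsub {i : Fin 3} {S : Finset V} (h : S ⊆ A i) : G.IsClique (S : Set V) :=
    (hA i).subset (Finset.coe_subset.2 h)
  have herase {i : Fin 3} {v : V} (hv : v ∈ A i) : ∀ w ∈ (A i).erase v, G.Adj v w :=
    fun w hw ↦ hA i hv (Finset.mem_of_mem_erase hw) (Finset.ne_of_mem_erase hw).symm
  have hupper (i : Fin 3) : 3 * ((A i).card : ℤ) ≤ n + 6 := by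
    obtain h | ⟨v, hv⟩ := (A i).eq_empty_or_nonempty
    · rw [h, Finset.card_empty]
      push_cast
      linarith
    · have h1 := htwo v ((A i).erase v) ∅ (hsub (Finset.erase_subset _ _)) (by simp)
        (Finset.disjoint_empty_right _) (herase hv) (by simp)
      have h2 : (((A i).erase v).card : ℤ) + 1 = (A i).card := by
        exact_mod_cast Finset.card_erase_add_one hv
      simp only [Finset.card_empty] at h1
      push_cast at h1
      nlinarith
  have hlower (i : Fin 3) : 24999 * (n : ℤ) ≤ 75000 * (A i).card := by
    have h0 := hupper 0
    have h1 := hupper 1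
    have h2 := hupper 2
    rw [Fin.sum_univ_three] at hsum
    have hsum' : (10 : ℤ) ^ 5 * n ≤ 10 ^ 5 * ((A 0).card + (A 1).card + (A 2).card) + n := by
      exact_mod_cast hsum
    fin_cases i <;> simp only [Fin.zero_eta, Fin.mk_one, Fin.reduceFinMk] <;> linarith
  have hclose (i j : Fin 3) (hij : i ≠ j) (v : V) (hv : v ∈ A i) : 200 * (M v j : ℤ) ≤ n := by
    by_contra! hcon
    have h1 := htwo v ((A i).erase v) ((A j).filter (G.Adj v ·)) (hsub (Finset.erase_subset _ _))
      (hsub (Finset.filter_subset _ _)) ((hdisj i j hij).mono (Finset.erase_subset _ _)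
        (Finset.filter_subset _ _)) (herase hv) fun w hw ↦ (Finset.mem_filter.1 hw).2
    have h2 : (((A i).erase v).card : ℤ) + 1 = (A i).card := by
      exact_mod_cast Finset.card_erase_add_one hv
    have h3 := hM v j
    have h4 := hlower i
    set s : ℤ := (((A i).erase v).card : ℤ)
    set b : ℤ := (((A j).filter (G.Adj v ·)).card : ℤ)
    have h5 : 24998 * (n : ℤ) ≤ 75000 * (s - 1) := by linarith
    have h6 : 49 * (n : ℤ) ≤ 10000 * (b - 1) := by linarith
    have h7 := mul_le_mul h5 h5 (by positivity) (by linarith)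
    have h8 := mul_le_mul h6 h6 (by positivity) (by linarith)
    nlinarith
  have hclass (v : V) : ∃ i, 100 * ((A i).card : ℤ) ≤ 100 * M v i + n := by
    by_contra! hcon
    have hpos : 0 < ((A 0).filter (Gᶜ.Adj v ·)).card := by
      have h1 := hMadd v 0
      have h2 := hcon 0
      omega
    obtain ⟨x, hx⟩ := Finset.card_pos.1 hpos
    obtain ⟨hx, hvx⟩ := Finset.mem_filter.1 hx
    obtain ⟨y, hy, hvy, hxy, -⟩ := exists_adj_triple Gᶜ (A 1) v x x (by
      have h1 := hclose 0 1 (by decide) x hx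
      have h2 := hcon 1
      simp only [M] at h1 h2
      omega)
    obtain ⟨z, hz, hvz, hxz, hyz⟩ := exists_adj_triple Gᶜ (A 2) v x y (by
      have h1 := hclose 0 2 (by decide) x hx
      have h2 := hclose 1 2 (by decide) y hy
      have h3 := hcon 2
      simp only [M] at h1 h2 h3
      omega)
    exact hfree v x y z hvx hvy hvz hxy hxz hyz
  have hfar (v : V) : ∃ i, ∀ j, j ≠ i → 10 * (M v j : ℤ) ≤ n := by
    obtain ⟨i, hi⟩ := hclass v
    refine ⟨i, fun j hji ↦ ?_⟩
    by_contra! hcon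
    have h1 := htwo v ((A i).filter (G.Adj v ·)) ((A j).filter (G.Adj v ·))
      (hsub (Finset.filter_subset _ _)) (hsub (Finset.filter_subset _ _))
      ((hdisj i j hji.symm).mono (Finset.filter_subset _ _) (Finset.filter_subset _ _))
      (fun w hw ↦ (Finset.mem_filter.1 hw).2) fun w hw ↦ (Finset.mem_filter.1 hw).2
    have h2 := hM v i
    have h3 := hM v j
    have h4 := hlower i
    set s : ℤ := (((A i).filter (G.Adj v ·)).card : ℤ)
    set b : ℤ := (((A j).filter (G.Adj v ·)).card : ℤ)
    have h5 : 32 * (n : ℤ) ≤ 100 * (s - 1) := by linarith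
    have h6 : 99 * (n : ℤ) ≤ 1000 * (b - 1) := by linarith
    have h7 := mul_le_mul h5 h5 (by positivity) (by linarith)
    have h8 := mul_le_mul h6 h6 (by positivity) (by linarith)
    nlinarith
  choose c hc using hfar
  refine ⟨c, fun u v huv huv' ↦ ?_⟩
  by_contra hadj
  have huv'' : Gᶜ.Adj u v := by simp [huv, hadj]
  obtain ⟨j, k, hj, hk, hjk⟩ :=
    (by decide : ∀ i : Fin 3, ∃ j k : Fin 3, j ≠ i ∧ k ≠ i ∧ j ≠ k) (c u)
  obtain ⟨y, hy, huy, hvy, -⟩ := exists_adj_triple Gᶜ (A j) u v v (by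
    have h1 := hc u j hj
    have h2 := hc v j (huv' ▸ hj)
    have h3 := hlower j
    simp only [M] at h1 h2
    omega)
  obtain ⟨z, hz, huz, hvz, hyz⟩ := exists_adj_triple Gᶜ (A k) u v y (by
    have h1 := hc u k hk
    have h2 := hc v k (huv' ▸ hk)
    have h3 := hlower k
    have h4 := hclose j k hjk y hy
    simp only [M] at h1 h2 h4
    omega)
  exact hfree u v y z huv'' huy huz hvy hvz hyz

/-- The number of triangles in the disjoint union of three balanced cliques on `n` vertices. -/
def balancedTriangles (n : ℕ) : ℕ :=
  (n / 3).choose 3 + ((n + 1) / 3).choose 3 + ((n + 2) / 3).choose 3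

theorem balancedTriangles_succ (n : ℕ) :
    balancedTriangles (n + 1) = balancedTriangles n + (n / 3).choose 2 := by
  have h : (n + 1 + 2) / 3 = n / 3 + 1 := by omega
  rw [balancedTriangles, balancedTriangles, h, Nat.choose_succ_succ' (n / 3) 2]
  ring_nf

theorem eighteen_mul_choose_two_le (n : ℕ) : 18 * (n / 3).choose 2 ≤ n ^ 2 := by
  have h1 := two_mul_choose_two (n / 3)
  have h2 : 3 * ((n / 3 : ℕ) : ℤ) ≤ n := by omega
  zify
  nlinarith

theorem balancedTriangles_le (n : ℕ) : 54 * balancedTriangles n ≤ n ^ 3 := by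
  induction n with
  | zero => simp [balancedTriangles]
  | succ n ih =>
    rw [balancedTriangles_succ]
    have := eighteen_mul_choose_two_le n
    nlinarith

theorem choose_three_tangent (a m : ℕ) :
    (m.choose 3 : ℤ) + (a - m) * m.choose 2 ≤ a.choose 3 := by
  obtain h | h := le_total m a
  · induction a, h using Nat.le_induction with
    | base => simp
    | succ a h ih =>
      rw [Nat.choose_succ_succ' a 2]
      have : (m.choose 2 : ℤ) ≤ a.choose 2 := by exact_mod_cast Nat.choose_le_choose 2 h
      push_cast
      linarith
  · induction m, h using Nat.le_induction with
    | base => simp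
    | succ m h ih =>
      rw [Nat.choose_succ_succ' m 2, Nat.choose_succ_succ' m 1, Nat.choose_one_right]
      have : (a : ℤ) ≤ m := by exact_mod_cast h
      push_cast
      nlinarith

theorem balancedTriangles_le_sum (a b c : ℕ) :
    balancedTriangles (a + b + c) ≤ a.choose 3 + b.choose 3 + c.choose 3 := by
  obtain ⟨m, h⟩ : ∃ m, m = (a + b + c) / 3 := ⟨_, rfl⟩
  have ha := choose_three_tangent a m
  have hb := choose_three_tangent b m
  have hc := choose_three_tangent c m
  have hbal : (balancedTriangles (a + b + c) : ℤ) =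
      3 * m.choose 3 + (a + b + c - 3 * m) * m.choose 2 := by
    have hsucc : (m + 1).choose 3 = m.choose 2 + m.choose 3 := Nat.choose_succ_succ' m 2
    have : a + b + c = 3 * m ∨ a + b + c = 3 * m + 1 ∨ a + b + c = 3 * m + 2 := by omega
    have h3 : (a : ℤ) + b + c = ((a + b + c : ℕ) : ℤ) := by push_cast; ring
    rw [h3]
    obtain h' | h' | h' := this <;> rw [h', balancedTriangles]
    · rw [show 3 * m / 3 = m by omega, show (3 * m + 1) / 3 = m by omega,
        show (3 * m + 2) / 3 = m by omega]
      push_cast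
      ring
    · rw [show (3 * m + 1) / 3 = m by omega, show (3 * m + 1 + 1) / 3 = m by omega,
        show (3 * m + 1 + 2) / 3 = m + 1 by omega, hsucc]
      push_cast
      ring
    · rw [show (3 * m + 2) / 3 = m by omega, show (3 * m + 2 + 1) / 3 = m + 1 by omega,
        show (3 * m + 2 + 2) / 3 = m + 1 by omega, hsucc]
      push_cast
      ring
  zify
  linarith

theorem balancedTriangles_le_of_three_cliques {V : Type*} [Fintype V] (G : SimpleGraph V)
    (c : V → Fin 3) (hc : ∀ u v, u ≠ v → c u = c v → G.Adj u v) :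
    balancedTriangles (Fintype.card V) ≤ cliqueCount G 3 := by
  classical
  let B (i : Fin 3) : Finset V := Finset.univ.filter (c · = i)
  have hcard : Fintype.card V = (B 0).card + (B 1).card + (B 2).card := by
    rw [← Finset.card_univ, Finset.card_eq_sum_card_fiberwise (f := c) (t := Finset.univ)
      (by simp), Fin.sum_univ_three]
  have hle : ∑ i, ((B i).powersetCard 3).card ≤ (G.cliqueFinset 3).card := by
    rw [← Finset.card_biUnion]
    · refine Finset.card_le_card fun s hs ↦ ?_
      obtain ⟨i, -, hi⟩ := Finset.mem_biUnion.1 hs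
      rw [Finset.mem_powersetCard] at hi
      rw [SimpleGraph.mem_cliqueFinset_iff, SimpleGraph.isNClique_iff]
      refine ⟨fun u hu v hv huv ↦ hc u v huv ?_, hi.2⟩
      rw [(Finset.mem_filter.1 (hi.1 hu)).2, (Finset.mem_filter.1 (hi.1 hv)).2]
    · intro i _ j _ hij
      rw [Function.onFun, Finset.disjoint_left]
      intro s hs hs'
      rw [Finset.mem_powersetCard] at hs hs'
      obtain ⟨w, hw⟩ := Finset.card_pos.1 (hs.2.symm ▸ three_pos : 0 < s.card)
      exact hij ((Finset.mem_filter.1 (hs.1 hw)).2.symm.trans (Finset.mem_filter.1 (hs'.1 hw)).2)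
  rw [Fin.sum_univ_three] at hle
  simp only [Finset.card_powersetCard] at hle
  rw [hcard, cliqueCount_eq_card_cliqueFinset]
  exact (balancedTriangles_le_sum _ _ _).trans hle

theorem exists_heavy_vertex {V : Type*} [Fintype V] [DecidableEq V] (G : SimpleGraph V)
    [DecidableRel G.Adj] (hG : IndepBound G 3) (hn : 10 ^ 13 ≤ Fintype.card V)
    (ht : cliqueCount G 3 < balancedTriangles (Fintype.card V)) :
    ∃ v, Fintype.card V ^ 2 < 18 * ((G.cliqueFinset 3).filter (v ∈ ·)).card := by
  by_contra! hlight
  have hfree (x y z w : V) (hxy : Gᶜ.Adj x y) (hxz : Gᶜ.Adj x z) (hxw : Gᶜ.Adj x w)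
      (hyz : Gᶜ.Adj y z) (hyw : Gᶜ.Adj y w) : ¬Gᶜ.Adj z w := by
    intro hzw
    have h := hG {x, y, z, w} (by
      simp only [SimpleGraph.compl_adj] at *
      simp only [Finset.mem_insert, Finset.mem_singleton]
      have := G.adj_comm
      grind)
    simp [hxy.ne, hxz.ne, hxw.ne, hyz.ne, hyw.ne, hzw.ne] at h
  let r (x y : V) : Bool := decide (Gᶜ.Adj x y)
  have hr (x y : V) : r x y = true ↔ Gᶜ.Adj x y := decide_eq_true_iff
  obtain ⟨x, y, z, hxy, hxz, hyz, hbad⟩ := exists_triangle_of_cliqueCount_le G r hr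
    (fun x y z w ↦ by
      by_contra h
      simp only [Bool.not_eq_false, Bool.and_eq_true, hr] at h
      exact hfree x y z w h.1.1.1.1.1 h.1.1.1.1.2 h.1.1.1.2 h.1.1.2 h.1.2 h.2) (10 ^ 5)
    (lt_of_lt_of_le (by norm_num) hn) (le_trans (by norm_num) hn)
    ((Nat.mul_le_mul_left 54 ht.le).trans (balancedTriangles_le _))
  rw [hr] at hxy hxz hyz
  obtain ⟨A, hA, hdisj, hcover⟩ := exists_partition_of_triangle G hfree ![x, y, z] (by
    intro i j hij
    fin_cases i <;> fin_cases j <;> simp_all [SimpleGraph.adj_comm])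
  obtain ⟨c, hc⟩ := exists_three_cliques G hfree A hA hdisj (le_trans (by norm_num) hn) (by
    have : (Finset.univ : Finset V).card ≤ (Finset.univ.biUnion A ∪
        Finset.univ.filter fun w ↦ atMostOne (r x w) (r y w) (r z w) = true).card := by
      refine Finset.card_le_card fun w _ ↦ ?_
      by_cases hw : ∃ i, w ∈ A i
      · exact Finset.mem_union_left _ (by simpa using hw)
      · refine Finset.mem_union_right _ (Finset.mem_filter.2 ⟨Finset.mem_univ _, ?_⟩)
        obtain ⟨i, hi⟩ := hcover w (not_exists.1 hw)
        have h0 := hi 0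
        have h1 := hi 1
        have h2 := hi 2
        simp only [Matrix.cons_val, ← hr, Bool.not_eq_true] at h0 h1 h2
        revert h0 h1 h2
        clear * -
        fin_cases i <;> simp +contextual [atMostOne]
    have h1 := this.trans ((Finset.card_union_le _ _).trans
      (Nat.add_le_add_right Finset.card_biUnion_le _))
    rw [Finset.card_univ] at h1
    linarith) hlight
  exact ht.not_ge (balancedTriangles_le_of_three_cliques G c hc)

theorem cliqueCount_comap_add_le {m : ℕ} (G : SimpleGraph (Fin (m + 1))) [DecidableRel G.Adj]
    (v : Fin (m + 1)) :
    cliqueCount (G.comap v.succAbove) 3 + ((G.cliqueFinset 3).filter (v ∈ ·)).card ≤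
      cliqueCount G 3 := by
  classical
  rw [cliqueCount_eq_card_cliqueFinset, cliqueCount_eq_card_cliqueFinset,
    ← Finset.card_filter_add_card_filter_not (s := G.cliqueFinset 3) (v ∈ ·), add_comm]
  gcongr
  refine Finset.card_le_card_of_injOn (Finset.map v.succAboveEmb) (fun s hs ↦ ?_)
    (Finset.map_injective _).injOn
  rw [Finset.mem_coe, SimpleGraph.mem_cliqueFinset_iff, SimpleGraph.isNClique_iff] at hs
  rw [Finset.mem_coe, Finset.mem_filter, SimpleGraph.mem_cliqueFinset_iff,
    SimpleGraph.isNClique_iff, Finset.card_map, Finset.coe_map]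
  refine ⟨⟨?_, hs.2⟩, ?_⟩
  · rintro _ ⟨u, hu, rfl⟩ _ ⟨w, hw, rfl⟩ huw
    exact hs.1 hu hw fun h ↦ huw (h ▸ rfl)
  · simp [Fin.succAbove_ne]

theorem IndepBound.comap {V W : Type*} {G : SimpleGraph V} {k : ℕ} (hG : IndepBound G k)
    (f : W ↪ V) : IndepBound (G.comap f) k := by
  intro s hs
  rw [← Finset.card_map f]
  refine hG _ fun u hu v hv huv ↦ ?_
  obtain ⟨u, hu', rfl⟩ := Finset.mem_map.1 hu
  obtain ⟨v, hv', rfl⟩ := Finset.mem_map.1 hv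
  exact hs u hu' v hv' fun h ↦ huv (h ▸ rfl)

/-- A deficit below the balanced count persists, and grows, under deletion of vertices. -/
theorem balancedTriangles_add_le {N : ℕ} (hN : 10 ^ 13 ≤ N) (k : ℕ)
    (G : SimpleGraph (Fin (N + k))) (hG : IndepBound G 3)
    (ht : cliqueCount G 3 < balancedTriangles (N + k)) :
    balancedTriangles (N + k) + k ≤ cliqueCount G 3 + balancedTriangles N := by
  classical
  induction k with
  | zero => simp
  | succ k ih =>
    change SimpleGraph (Fin (N + k + 1)) at G
    obtain ⟨v, hv⟩ := exists_heavy_vertex G hG (by rw [Fintype.card_fin]; omega)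
      (by rwa [Fintype.card_fin])
    have h1 := cliqueCount_comap_add_le G v
    have h2 := balancedTriangles_succ (N + k)
    have h3 := eighteen_mul_choose_two_le (N + k)
    have h4 := ih (G.comap v.succAbove) (hG.comap v.succAboveEmb)
    rw [Fintype.card_fin] at hv
    change _ < balancedTriangles (N + k + 1) at ht
    change balancedTriangles (N + k + 1) + (k + 1) ≤ _
    have h5 : (N + k) ^ 2 < (N + k + 1) ^ 2 :=
      Nat.pow_lt_pow_left (Nat.lt_succ_self _) two_ne_zero
    omega

theorem card_filter_mod_three (n : ℕ) :
    ((Finset.range n).filter (· % 3 = 0)).card = (n + 2) / 3 ∧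
      ((Finset.range n).filter (· % 3 = 1)).card = (n + 1) / 3 ∧
      ((Finset.range n).filter (· % 3 = 2)).card = n / 3 := by
  induction n with
  | zero => simp
  | succ n ih =>
    simp only [Finset.range_add_one, Finset.filter_insert]
    have h (p : ℕ → Prop) [DecidablePred p] : n ∉ (Finset.range n).filter p := by simp
    split_ifs <;> (try rw [Finset.card_insert_of_notMem (h _)]) <;> omega

/-- The graph on `Fin n` joining distinct vertices congruent modulo three. -/
def residueGraph (n : ℕ) : SimpleGraph (Fin n) where
  Adj u v := u ≠ v ∧ (u : ℕ) % 3 = v % 3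
  symm := ⟨fun _ _ h ↦ ⟨h.1.symm, h.2.symm⟩⟩
  loopless := ⟨fun _ h ↦ h.1 rfl⟩

theorem indepBound_residueGraph (n : ℕ) : IndepBound (residueGraph n) 3 := by
  intro s hs
  rw [← Finset.card_range 3]
  refine Finset.card_le_card_of_injOn (fun u ↦ (u : ℕ) % 3) (fun u _ ↦ ?_) fun u hu v hv h ↦ ?_
  · simp [Nat.mod_lt]
  · by_contra huv
    exact hs u hu v hv huv ⟨huv, h⟩

theorem cliqueCount_residueGraph_le (n : ℕ) :
    cliqueCount (residueGraph n) 3 ≤ balancedTriangles n := by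
  classical
  let B (i : ℕ) : Finset (Fin n) := Finset.univ.filter fun u ↦ (u : ℕ) % 3 = i
  have hB (i : ℕ) : (B i).card = ((Finset.range n).filter (· % 3 = i)).card := by
    simp only [B, Finset.card_filter, Finset.sum_range]
  have hsub : (residueGraph n).cliqueFinset 3 ⊆
      (B 2).powersetCard 3 ∪ (B 1).powersetCard 3 ∪ (B 0).powersetCard 3 := by
    intro s hs
    rw [SimpleGraph.mem_cliqueFinset_iff, SimpleGraph.isNClique_iff] at hs
    obtain ⟨w, hw⟩ := Finset.card_pos.1 (hs.2.symm ▸ three_pos : 0 < s.card)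
    have hsB : s ∈ (B (w % 3)).powersetCard 3 := by
      refine Finset.mem_powersetCard.2 ⟨fun u hu ↦ Finset.mem_filter.2 ⟨Finset.mem_univ _, ?_⟩,
        hs.2⟩
      by_cases h : u = w
      · rw [h]
      · exact (hs.1 hu hw h).2
    simp only [Finset.mem_union]
    obtain h | h | h : (w : ℕ) % 3 = 0 ∨ (w : ℕ) % 3 = 1 ∨ (w : ℕ) % 3 = 2 := by omega
    all_goals rw [h] at hsB; simp only [hsB, true_or, or_true]
  obtain ⟨h0, h1, h2⟩ := card_filter_mod_three n
  rw [cliqueCount_eq_card_cliqueFinset, balancedTriangles, ← h0, ← h1, ← h2, ← hB, ← hB, ← hB]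
  simp only [← Finset.card_powersetCard]
  exact (Finset.card_le_card hsub).trans ((Finset.card_union_le _ _).trans
    (Nat.add_le_add_right (Finset.card_union_le _ _) _))

/-- For all large n,
f(n,3,4) = C(⌊n/3⌋,3) + C(⌊(n+1)/3⌋,3) + C(⌊(n+2)/3⌋,3). -/
theorem erdos_34_exact_value :
    ∃ n₀ : ℕ, ∀ n : ℕ, n₀ ≤ n →
      minCliques n 3 4 =
        (n / 3).choose 3 + ((n + 1) / 3).choose 3 + ((n + 2) / 3).choose 3 := by
  obtain ⟨N, hN⟩ : ∃ N : ℕ, 10 ^ 13 ≤ N := ⟨_, le_rfl⟩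
  refine ⟨N + balancedTriangles N, fun n hn ↦ ?_⟩
  change _ = balancedTriangles n
  obtain ⟨k, rfl⟩ := Nat.exists_eq_add_of_le (le_of_add_le_left hn)
  have hmem : cliqueCount (residueGraph (N + k)) 3 ∈ {m | ∃ G : SimpleGraph (Fin (N + k)),
      IndepBound G (4 - 1) ∧ cliqueCount G 3 = m} := ⟨_, indepBound_residueGraph _, rfl⟩
  refine le_antisymm ((Nat.sInf_le hmem).trans (cliqueCount_residueGraph_le _)) ?_
  obtain ⟨G, hG, hcount⟩ := Nat.sInf_mem ⟨_, hmem⟩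
  change _ ≤ sInf _
  rw [← hcount]
  by_contra! h
  have := balancedTriangles_add_le hN k G hG h
  omega
end
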